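/- (Frobenius Formula) Let ρ = (ρ_1, …, ρ_l) be a partition of n. Then in ℂ[x_1, x_2, …] one has the identity Π_{i=1}^{l} ρ_i x_{ρ_i} = Σ_{λ ⊢ n} χ^λ(c_ρ) S_λ, where the sum is over all partitions λ of n, and χ^λ(c_ρ) denotes the value of the character of the representation V^λ of S_n given by Young's orthogonal form at any permutation c_ρ ∈ S_n of cycle type ρ. -/

import Mathlib

/-- `T : Fin n → ℕ × ℕ` is a standard tableau of shape `μ` (a Young diagram with `n`
cells): `T` is a bijection from 0-indexed entries (`T k` is the box containing the entry
`k+1`) onto the cells of `μ` such that entries increase along rows and down columns. -/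
def IsStandardTableau (μ : YoungDiagram) (n : ℕ) (T : Fin n → ℕ × ℕ) : Prop :=
  Function.Injective T ∧ Set.range T = (μ.cells : Set (ℕ × ℕ)) ∧
    ∀ j k : Fin n,
      (((T k).1 = (T j).1 ∧ (T k).2 = (T j).2 + 1) ∨
       ((T k).1 = (T j).1 + 1 ∧ (T k).2 = (T j).2)) → j < k

/-- The complex vector space `V^μ` with basis indexed by the standard `μ`-tableaux. -/
abbrev YoungSpace (μ : YoungDiagram) (n : ℕ) : Type :=
  {T : Fin n → ℕ × ℕ // IsStandardTableau μ n T} → ℂ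

/-- The coefficient `ρ = 1/(cont T_{q} − cont T_{p})` featuring in Young's orthogonal
form, where `cont (r, s) = s − r` (here `p`, `q` are 0-indexed entry positions). -/
noncomputable def rhoCoef {n : ℕ} (p q : Fin n) (T : Fin n → ℕ × ℕ) : ℝ :=
  ((((T q).2 : ℝ) - ((T q).1 : ℝ)) - (((T p).2 : ℝ) - ((T p).1 : ℝ)))⁻¹

open scoped Classical in
/-- The operator of Young's orthogonal form attached to the simple transposition
swapping the (0-indexed) entries `p` and `q = p + 1`:  on the basis vector `w_T` it acts
by `w_T ↦ ρ w_T + √(1 − ρ²) w_{s T}` where `ρ = 1/(cont T_{q} − cont T_{p})` and `s T`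
is `T` with the entries `p, q` swapped (the second term being omitted when `s T` is not
standard, in which case `√(1 − ρ²) = 0`). -/
noncomputable def youngOp (μ : YoungDiagram) (n : ℕ) (p q : Fin n) :
    Module.End ℂ (YoungSpace μ n) where
  toFun f := fun S =>
    (rhoCoef p q S.val : ℂ) * f S +
      ((Real.sqrt (1 - (rhoCoef p q S.val) ^ 2) : ℝ) : ℂ) *
        (if h : IsStandardTableau μ n (S.val ∘ Equiv.swap p q) then
          f ⟨S.val ∘ Equiv.swap p q, h⟩ else 0)
  map_add' f g := by
    funext S
    by_cases h : IsStandardTableau μ n (S.val ∘ Equiv.swap p q) <;>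
      simp [h] <;> ring
  map_smul' c f := by
    funext S
    by_cases h : IsStandardTableau μ n (S.val ∘ Equiv.swap p q) <;>
      simp [h] <;> ring

/-- A representation of `Sₙ` on `V^μ` is "the" Young orthogonal form representation if
every adjacent transposition `(p, p+1)` acts by the orthogonal-form operator. -/
def IsYoungOrthogonalRep (μ : YoungDiagram) (n : ℕ)
    (ρ : Representation ℂ (Equiv.Perm (Fin n)) (YoungSpace μ n)) : Prop :=
  ∀ p q : Fin n, (q : ℕ) = (p : ℕ) + 1 → ρ (Equiv.swap p q) = youngOp μ n p q

open scoped Classical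

/-- The elementary Schur polynomial `S_k` in `ℂ[x₁, x₂, …]` (the variable `xₙ` is
`MvPolynomial.X (n-1)`):  `S_k = Σ_{k₁+2k₂+⋯ = k} x₁^{k₁} x₂^{k₂} ⋯ /(k₁! k₂! ⋯)` for
`k ≥ 0` and `S_k = 0` for `k < 0`. -/
noncomputable def elemSchur (k : ℤ) : MvPolynomial ℕ ℂ :=
  if k < 0 then 0 else
    ∑ᶠ d : ℕ →₀ ℕ, if (d.sum fun i m => (i + 1) * m) = k.toNat then
      MvPolynomial.monomial d ((∏ i ∈ d.support, (Nat.factorial (d i) : ℂ))⁻¹) else 0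

/-- The Schur polynomial `S_μ = det (S_{μ_i + j − i})_{1 ≤ i,j ≤ N}` of a partition `μ`
(with `N` the number of nonzero rows of `μ` and `μ_i = rowLen (i-1)`). -/
noncomputable def schurPoly (μ : YoungDiagram) : MvPolynomial ℕ ℂ :=
  Matrix.det (Matrix.of fun i j : Fin (μ.colLen 0) =>
    elemSchur ((μ.rowLen i : ℤ) + (j : ℤ) - (i : ℤ)))

open scoped Classical

theorem es_wt_finite (k : ℕ) : {d : ℕ →₀ ℕ | (d.sum fun i m => (i + 1) * m) = k}.Finite := by
  apply Set.Finite.subset (Set.finite_Iic (Finsupp.indicator (Finset.range k) (fun _ _ => k)))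
  intro d hd
  simp only [Set.mem_ofPred_eq] at hd
  rw [Set.mem_Iic, Finsupp.le_def]
  intro i
  by_cases h0 : d i = 0
  · simp [h0]
  have h1 : (i + 1) * d i ≤ k := by
    rw [← hd, Finsupp.sum]
    exact Finset.single_le_sum (f := fun i => (i + 1) * d i) (fun _ _ => Nat.zero_le _)
      (Finsupp.mem_support_iff.2 h0)
  have h2 : d i ≤ k := by nlinarith
  have h3 : i < k := by
    have : 1 ≤ d i := Nat.one_le_iff_ne_zero.2 h0
    nlinarith
  rw [Finsupp.indicator_apply]
  simp [h3, h2]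

theorem es_coeff (k : ℕ) (d : ℕ →₀ ℕ) : (elemSchur k).coeff d =
    if (d.sum fun i m => (i + 1) * m) = k then (d.prod fun _ m => ((Nat.factorial m : ℂ))⁻¹) else 0 := by
  unfold elemSchur
  rw [if_neg (by simp)]
  have key := AddMonoidHom.map_finsum (MvPolynomial.coeffAddMonoidHom (R := ℂ) d)
    (f := fun d : ℕ →₀ ℕ => if (d.sum fun i m => (i + 1) * m) = (k : ℤ).toNat then
      MvPolynomial.monomial d ((∏ i ∈ d.support, (Nat.factorial (d i) : ℂ))⁻¹) else 0)
    (by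
      apply (es_wt_finite k).subset
      intro d hd
      by_contra h
      simp only [Set.mem_ofPred_eq] at h
      simp [h] at hd)
  simp only [MvPolynomial.coeffAddMonoidHom_apply] at key
  rw [key, finsum_eq_single _ d]
  · simp only [Int.toNat_natCast]
    split_ifs
    · rw [MvPolynomial.coeff_monomial, if_pos rfl, Finsupp.prod, Finset.prod_inv_distrib]
    · simp
  · intro x hx
    split_ifs
    · rw [MvPolynomial.coeff_monomial, if_neg hx]
    · simp

theorem es_neg {k : ℤ} (h : k < 0) : elemSchur k = 0 := by
  unfold elemSchur; rw [if_pos h]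

theorem es_wt_zero (d : ℕ →₀ ℕ) : (d.sum fun i m => (i + 1) * m) = 0 ↔ d = 0 := by
  constructor
  · intro h
    ext i
    by_contra h0
    rw [Finsupp.sum, Finset.sum_eq_zero_iff] at h
    have := h i (Finsupp.mem_support_iff.2 h0)
    simp at this
    exact h0 this
  · rintro rfl; simp

theorem es_zero : elemSchur 0 = 1 := by
  ext d
  have := es_coeff 0 d
  rw [Nat.cast_zero] at this
  rw [this, MvPolynomial.coeff_one]
  by_cases h : d = 0
  · subst h; simp
  · rw [if_neg (mt (es_wt_zero d).1 h), if_neg (Ne.symm h)]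

theorem es_newton (k : ℕ) : (k : ℂ) • elemSchur k =
    ∑ i ∈ Finset.range k, ((i : ℂ) + 1) • (MvPolynomial.X i * elemSchur ((k - 1 - i : ℕ) : ℤ)) := by
  ext d
  rw [MvPolynomial.coeff_smul, es_coeff, MvPolynomial.coeff_sum]
  simp only [MvPolynomial.coeff_smul, MvPolynomial.coeff_X_mul', es_coeff]
  have hdec : ∀ i ∈ d.support, d = (d - Finsupp.single i 1) + Finsupp.single i 1 := by
    intro i hi
    rw [tsub_add_cancel_of_le]
    rw [Finsupp.single_le_iff]
    exact Nat.one_le_iff_ne_zero.2 (Finsupp.mem_support_iff.1 hi)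
  have hwt : ∀ i ∈ d.support, (d.sum fun i m => (i + 1) * m) =
      ((d - Finsupp.single i 1).sum fun i m => (i + 1) * m) + (i + 1) := by
    intro i hi
    conv_lhs => rw [hdec i hi]
    rw [Finsupp.sum_add_index' (by simp) (by intros; ring)]
    simp
  have hpr : ∀ i ∈ d.support, ((d - Finsupp.single i 1).prod fun _ m => ((Nat.factorial m : ℂ))⁻¹) =
      (d i : ℂ) * (d.prod fun _ m => ((Nat.factorial m : ℂ))⁻¹) := by
    intro i hi
    have h1 : 1 ≤ d i := Nat.one_le_iff_ne_zero.2 (Finsupp.mem_support_iff.1 hi)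
    rw [← Finsupp.mul_prod_erase d i _ hi]
    by_cases h2 : i ∈ (d - Finsupp.single i 1).support
    · rw [← Finsupp.mul_prod_erase _ i _ h2]
      have : (d - Finsupp.single i 1).erase i = d.erase i := by
        ext j
        by_cases hj : j = i
        · subst hj; simp
        · simp [Finsupp.erase_ne hj, Finsupp.single_apply, Ne.symm hj]
      rw [this, ← mul_assoc]
      congr 1
      obtain ⟨m, hm⟩ := Nat.exists_eq_add_of_le' h1
      simp only [Finsupp.coe_tsub, Pi.sub_apply, Finsupp.single_eq_same, hm, Nat.add_sub_cancel]
      rw [Nat.factorial_succ]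
      push_cast
      have : ((m : ℂ) + 1) ≠ 0 := by exact_mod_cast Nat.succ_ne_zero m
      have h3 : (m.factorial : ℂ) ≠ 0 := by exact_mod_cast Nat.factorial_ne_zero m
      field_simp
    · have h3 : d i = 1 := by
        simp at h2
        omega
      have : d - Finsupp.single i 1 = d.erase i := by
        ext j
        by_cases hj : j = i
        · subst hj; simp [h3]
        · simp [Finsupp.erase_ne hj, Finsupp.single_apply, Ne.symm hj]
      rw [this, h3]
      simp
  by_cases hk : (d.sum fun i m => (i + 1) * m) = k
  · rw [if_pos hk]
    have hsub : d.support ⊆ Finset.range k := by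
      intro i hi
      have := hwt i hi
      rw [Finset.mem_range]; omega
    rw [← Finset.sum_subset hsub (by intro i _ hi; rw [if_neg hi, smul_zero])]
    rw [Finset.sum_congr rfl (g := fun i => (((i + 1) * d i : ℕ) : ℂ) * (d.prod fun _ m => ((Nat.factorial m : ℂ))⁻¹))]
    · rw [← Finset.sum_mul, ← Nat.cast_sum]
      congr 2
      exact hk.symm
    · intro i hi
      rw [if_pos hi, if_pos, hpr i hi]
      · push_cast; rw [smul_eq_mul]; ring
      · have := hwt i hi
        omega
  · rw [if_neg hk, smul_zero, Finset.sum_eq_zero]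
    intro i hi
    rw [Finset.mem_range] at hi
    split_ifs with h1 h2
    · have := hwt i h1
      omega
    · simp
    · simp

theorem es_one : elemSchur 1 = MvPolynomial.X 0 := by
  have := es_newton 1
  simpa [es_zero] using this

/-- The derivation `∑ (r+1) x_{r+1} ∂/∂x_r`. -/
noncomputable def dD : Derivation ℂ (MvPolynomial ℕ ℂ) (MvPolynomial ℕ ℂ) :=
  MvPolynomial.mkDerivation ℂ (fun i => ((i : ℂ) + 2) • MvPolynomial.X (i + 1))

theorem dD_X (i : ℕ) : dD (MvPolynomial.X i) = ((i : ℂ) + 2) • MvPolynomial.X (i + 1) := by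
  simp [dD]

theorem dD_es_nat (k : ℕ) : dD (elemSchur k) =
    ((k : ℂ) + 1) • elemSchur ((k + 1 : ℕ) : ℤ) - MvPolynomial.X 0 * elemSchur k := by
  induction k using Nat.strong_induction_on with
  | _ k ih =>
  rcases Nat.eq_zero_or_pos k with rfl | hk
  · simp [es_zero, es_one]
  have hk0 : (k : ℂ) ≠ 0 := by exact_mod_cast hk.ne'
  have h1 := congrArg dD (es_newton k)
  rw [Derivation.map_smul, map_sum] at h1
  have hN := es_newton (k + 1)
  have hN' := es_newton k
  have : (k : ℂ) • dD (elemSchur k) = (k : ℂ) • (((k : ℂ) + 1) • elemSchur ((k + 1 : ℕ) : ℤ) - MvPolynomial.X 0 * elemSchur k) := by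
    rw [h1, smul_sub]
    push_cast at hN
    rw [Nat.cast_add, Nat.cast_one, hN, ← mul_smul_comm, hN', Finset.smul_sum, Finset.mul_sum]
    have e1 : ∀ i ∈ Finset.range k, dD (((i : ℂ) + 1) • (MvPolynomial.X i * elemSchur ((k - 1 - i : ℕ) : ℤ)))
        = (((i + 1 : ℕ) : ℂ) * (((i + 1 : ℕ) : ℂ) + 1)) • (MvPolynomial.X (i+1) * elemSchur ((k - (i + 1) : ℕ) : ℤ))
          + ((((i : ℂ) + 1) * ((k : ℂ) - i)) • (MvPolynomial.X i * elemSchur ((k - i : ℕ) : ℤ))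
          - MvPolynomial.X 0 * (((i : ℂ) + 1) • (MvPolynomial.X i * elemSchur ((k - 1 - i : ℕ) : ℤ)))) := by
      intro i hi
      rw [Finset.mem_range] at hi
      rw [Derivation.map_smul, Derivation.leibniz, ih (k - 1 - i) (by omega), dD_X]
      have a1 : k - 1 - i + 1 = k - i := by omega
      have a2 : k - (i + 1) = k - 1 - i := by omega
      have a3 : ((k - 1 - i : ℕ) : ℂ) = (k : ℂ) - 1 - i := by
        rw [Nat.cast_sub (by omega), Nat.cast_sub (by omega)]; simp
      rw [a1, a2, a3]
      simp only [MvPolynomial.smul_eq_C_mul, smul_eq_mul, map_add, map_sub, map_mul, map_one, Nat.cast_add, Nat.cast_one]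
      have : (MvPolynomial.C 2 : MvPolynomial ℕ ℂ) = 1 + 1 := by
        rw [← MvPolynomial.C_1, ← map_add]; norm_num
      rw [this]
      ring
    rw [Finset.sum_congr rfl e1, Finset.sum_add_distrib, Finset.sum_sub_distrib, ← add_sub_assoc]
    congr 1
    have e2 := Finset.sum_range_succ' (fun i : ℕ => ((i : ℂ) * ((i : ℂ) + 1)) • (MvPolynomial.X i * elemSchur ((k - i : ℕ) : ℤ))) k
    rw [Nat.cast_zero, zero_mul, zero_smul, add_zero] at e2
    have e3 := Finset.sum_range_succ (fun i : ℕ => (((i : ℂ) + 1) * ((k : ℂ) - i)) • (MvPolynomial.X i * elemSchur ((k - i : ℕ) : ℤ))) k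
    rw [sub_self, mul_zero, zero_smul, add_zero] at e3
    rw [← e2, ← e3, ← Finset.sum_add_distrib]
    apply Finset.sum_congr rfl
    intro i _
    rw [← add_smul, smul_smul]
    congr 1
    ring
  exact smul_right_injective _ hk0 this

theorem dD_es (k : ℤ) : dD (elemSchur k) =
    ((k : ℂ) + 1) • elemSchur (k + 1) - MvPolynomial.X 0 * elemSchur k := by
  rcases lt_or_ge k 0 with h | h
  · rw [es_neg h]
    rcases eq_or_ne k (-1) with rfl | h1
    · simp
    · rw [es_neg (by omega : k + 1 < 0)]; simp
  · lift k to ℕ using h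
    have := dD_es_nat k
    push_cast at this ⊢
    exact this

open scoped Classical

theorem dv_prod {ι : Type*} [DecidableEq ι] (D : Derivation ℂ (MvPolynomial ℕ ℂ) (MvPolynomial ℕ ℂ))
    (s : Finset ι) (f : ι → MvPolynomial ℕ ℂ) :
    D (∏ i ∈ s, f i) = ∑ i ∈ s, D (f i) * ∏ k ∈ s.erase i, f k := by
  induction s using Finset.induction_on with
  | empty => simp
  | insert a s ha ih =>
    rw [Finset.prod_insert ha, Derivation.leibniz, ih, Finset.sum_insert ha, Finset.erase_insert ha,
      smul_eq_mul, smul_eq_mul, add_comm, mul_comm]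
    congr 1
    rw [Finset.mul_sum]
    apply Finset.sum_congr rfl
    intro i hi
    have : a ≠ i := fun h => ha (h ▸ hi)
    rw [Finset.erase_insert_of_ne this, Finset.prod_insert (by simp [ha])]
    ring

theorem dv_det {N : ℕ} (D : Derivation ℂ (MvPolynomial ℕ ℂ) (MvPolynomial ℕ ℂ))
    (M : Matrix (Fin N) (Fin N) (MvPolynomial ℕ ℂ)) :
    D M.det = ∑ j, (M.updateCol j (fun i => D (M i j))).det := by
  simp only [Matrix.det_apply]
  rw [Finset.sum_comm, map_sum]
  apply Finset.sum_congr rfl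
  intro σ _
  rw [← Finset.smul_sum, Units.smul_def, Units.smul_def, map_zsmul, dv_prod]
  congr 1
  apply Finset.sum_congr rfl
  intro j _
  rw [← Finset.mul_prod_erase Finset.univ _ (Finset.mem_univ j)]
  congr 1
  · simp
  · apply Finset.prod_congr rfl
    intro i hi
    rw [Matrix.updateCol_ne (Finset.ne_of_mem_erase hi)]

theorem sum_updateRow_eq {N : ℕ} (M : Matrix (Fin N) (Fin N) (MvPolynomial ℕ ℂ))
    (M' : Fin N → Fin N → MvPolynomial ℕ ℂ) :
    ∑ i, (M.updateRow i (M' i)).det = ∑ j, (M.updateCol j (fun i => M' i j)).det := by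
  have h1 : ∀ i, (M.updateRow i (M' i)).det = ∑ j, M.adjugate j i * M' i j := by
    intro i
    rw [← Matrix.cramer_transpose_apply, Matrix.cramer_eq_adjugate_mulVec, ← Matrix.adjugate_transpose]
    rfl
  have h2 : ∀ j, (M.updateCol j (fun i => M' i j)).det = ∑ i, M.adjugate j i * M' i j := by
    intro i
    rw [← Matrix.cramer_apply, Matrix.cramer_eq_adjugate_mulVec]
    rfl
  simp only [h1, h2]
  exact Finset.sum_comm

/-- Jacobi-Trudi matrices with arbitrary integer row data. -/
noncomputable def jtM {N : ℕ} (a : Fin N → ℤ) : Matrix (Fin N) (Fin N) (MvPolynomial ℕ ℂ) :=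
  Matrix.of fun i j => elemSchur (a i + j)

theorem jtM_update {N : ℕ} (a : Fin N → ℤ) (i : Fin N) :
    jtM (a + Pi.single i 1) = (jtM a).updateRow i (fun j => elemSchur (a i + 1 + j)) := by
  ext r j : 2
  by_cases h : r = i
  · subst h; simp [jtM]
  · simp [jtM, Matrix.updateRow_ne h, h]

theorem jt_last_det {K : ℕ} (M : Matrix (Fin (K+1)) (Fin (K+1)) (MvPolynomial ℕ ℂ))
    (h : ∀ j : Fin K, M (Fin.last K) j.castSucc = 0) :
    M.det = M (Fin.last K) (Fin.last K) * (M.submatrix Fin.castSucc Fin.castSucc).det := by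
  rw [Matrix.det_succ_row M (Fin.last K), Fin.sum_univ_castSucc]
  rw [Finset.sum_eq_zero]
  · simp [← two_mul]
  · intro j _
    rw [h]; simp

theorem jt_shift_cols {K : ℕ} (a : Fin (K+1) → ℤ) (ha : a (Fin.last K) = -(K : ℤ)) (w : ℕ → ℂ) :
    ∑ i, ((jtM a).updateRow i (fun j => w j • elemSchur (a i + 1 + j))).det =
      w K • (MvPolynomial.X 0 * (jtM a).det) := by
  rw [sum_updateRow_eq (jtM a) (fun i j => w j • elemSchur (a i + 1 + j))]
  rw [Fin.sum_univ_castSucc, Finset.sum_eq_zero, zero_add]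
  · rw [jt_last_det, jt_last_det (jtM a)]
    · have : ((jtM a).updateCol (Fin.last K) fun i => w ((Fin.last K : Fin (K+1)) : ℕ) • elemSchur (a i + 1 + ((Fin.last K : Fin (K+1)) : ℕ))).submatrix Fin.castSucc Fin.castSucc = (jtM a).submatrix Fin.castSucc Fin.castSucc := by
        ext r j : 2
        simp [Matrix.updateCol_ne]
      rw [this]
      simp [jtM, ha, es_zero, es_one]
    · intro j
      simp only [jtM, Matrix.of_apply, ha]
      exact es_neg (by simp)
    · intro j
      rw [Matrix.updateCol_ne (by simp [Fin.ext_iff]; have := j.2; omega)]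
      simp only [jtM, Matrix.of_apply, ha]
      exact es_neg (by simp)
  · intro j _
    have : (fun i => w (j.castSucc : ℕ) • elemSchur (a i + 1 + (j.castSucc : ℕ))) =
      (MvPolynomial.C (w j) : MvPolynomial ℕ ℂ) • (fun i => jtM a i j.succ) := by
      ext i : 1
      simp [jtM, MvPolynomial.smul_eq_C_mul]
      left; congr 1; ring
    rw [this, Matrix.det_updateCol_smul]
    rw [Matrix.det_zero_of_column_eq (i := j.castSucc) (j := j.succ)]
    · simp
    · exact (Fin.castSucc_lt_succ).ne
    · intro k
      rw [Matrix.updateCol_self, Matrix.updateCol_ne (Fin.castSucc_lt_succ).ne']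

theorem jt_pieri {K : ℕ} (a : Fin (K+1) → ℤ) (ha : a (Fin.last K) = -(K : ℤ)) :
    ∑ i, (jtM (a + Pi.single i 1)).det = MvPolynomial.X 0 * (jtM a).det := by
  have := jt_shift_cols a ha (fun _ => 1)
  simp only [one_smul] at this
  rw [← this]
  simp only [jtM_update]

theorem jt_D {K : ℕ} (a : Fin (K+1) → ℤ) (ha : a (Fin.last K) = -(K : ℤ)) :
    ∑ i, (a i : ℂ) • (jtM (a + Pi.single i 1)).det = dD (jtM a).det := by
  have h1 := jt_shift_cols a ha (fun j => (j : ℂ) + 1)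
  rw [dv_det, ← sum_updateRow_eq (jtM a) (fun i j => dD (jtM a i j))]
  have h2 : ∀ i, ((jtM a).updateRow i ((fun j => dD (jtM a i j)))).det =
      (a i : ℂ) • (jtM (a + Pi.single i 1)).det +
      (((jtM a).updateRow i (fun j => (((j : ℕ) : ℂ) + 1) • elemSchur (a i + 1 + j))).det
        - MvPolynomial.X 0 * (jtM a).det) := by
    intro i
    have : (fun j => dD (jtM a i j)) = ((MvPolynomial.C (a i : ℂ) : MvPolynomial ℕ ℂ) • (fun j : Fin (K+1) => elemSchur (a i + 1 + j)))
      + ((fun j : Fin (K+1) => (((j : ℕ) : ℂ) + 1) • elemSchur (a i + 1 + j)) + (-MvPolynomial.X 0 : MvPolynomial ℕ ℂ) • jtM a i) := by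
      ext j : 1
      simp only [Matrix.of_apply, jtM, dD_es, Pi.add_apply, Pi.smul_apply, smul_eq_mul]
      rw [show a i + (j : ℤ) + 1 = a i + 1 + j by ring]
      simp only [MvPolynomial.smul_eq_C_mul, map_add]
      push_cast
      simp only [map_add]
      ring
    rw [this, Matrix.det_updateRow_add, Matrix.det_updateRow_add, Matrix.det_updateRow_smul,
      Matrix.det_updateRow_smul, Matrix.updateRow_eq_self, jtM_update, MvPolynomial.smul_eq_C_mul]
    ring
  rw [Finset.sum_congr rfl (fun i _ => h2 i), Finset.sum_add_distrib, Finset.sum_sub_distrib, h1]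
  simp [MvPolynomial.smul_eq_C_mul]

open scoped Classical

theorem yd_rowLen_eq {μ : YoungDiagram} {r m : ℕ} (h : ∀ j, (r, j) ∈ μ ↔ j < m) : μ.rowLen r = m := by
  have h1 := fun j => (YoungDiagram.mem_iff_lt_rowLen (μ := μ) (i := r) (j := j)).symm.trans (h j)
  have h2 := h1 m
  have h3 := h1 (μ.rowLen r)
  omega

theorem yd_rowLen_zero {μ : YoungDiagram} {r : ℕ} (h : μ.colLen 0 ≤ r) : μ.rowLen r = 0 := by
  by_contra h1
  have : (r, 0) ∈ μ := YoungDiagram.mem_iff_lt_rowLen.2 (by omega)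
  rw [YoungDiagram.mem_iff_lt_colLen] at this
  omega

/-- Row data of a Young diagram. -/
def rowData (μ : YoungDiagram) (N : ℕ) : Fin N → ℤ := fun i => (μ.rowLen i : ℤ) - (i : ℕ)

theorem schurPoly_pad (μ : YoungDiagram) (N : ℕ) (h : μ.colLen 0 ≤ N) :
    schurPoly μ = (jtM (rowData μ N)).det := by
  induction N, h using Nat.le_induction with
  | base =>
    unfold schurPoly jtM rowData
    congr 2
    ext i j : 2
    congr 1
    ring
  | succ N hN ih =>
    rw [ih, jt_last_det]
    · have : (jtM (rowData μ (N+1))).submatrix Fin.castSucc Fin.castSucc = jtM (rowData μ N) := by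
        ext i j : 2
        simp [jtM, rowData]
      rw [this]
      simp [jtM, rowData, yd_rowLen_zero hN, es_zero]
    · intro j
      simp only [jtM, rowData, Matrix.of_apply, Fin.val_last, yd_rowLen_zero hN]
      apply es_neg
      simp

theorem yd_finite (n : ℕ) : {μ : YoungDiagram | μ.card = n}.Finite := by
  apply Set.Finite.of_finite_image (f := YoungDiagram.cells)
  · apply Set.Finite.subset ((Finset.range n ×ˢ Finset.range n).powerset.finite_toSet)
    rintro s ⟨μ, hμ, rfl⟩
    simp only [Set.mem_ofPred_eq] at hμ
    simp only [Finset.coe_powerset, Set.mem_preimage, Set.mem_powerset_iff, Finset.coe_subset]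
    rintro ⟨r, s⟩ h
    rw [YoungDiagram.mem_cells] at h
    rw [Finset.mem_product, Finset.mem_range, Finset.mem_range]
    constructor
    · have h1 : r < μ.colLen s := YoungDiagram.mem_iff_lt_colLen.1 h
      have h2 : μ.colLen s ≤ n := by
        rw [YoungDiagram.colLen_eq_card, ← hμ]
        exact Finset.card_le_card (Finset.filter_subset _ _)
      exact lt_of_lt_of_le h1 h2
    · have h1 : s < μ.rowLen r := YoungDiagram.mem_iff_lt_rowLen.1 h
      have h2 : μ.rowLen r ≤ n := by
        rw [YoungDiagram.rowLen_eq_card, ← hμ]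
        exact Finset.card_le_card (Finset.filter_subset _ _)
      exact lt_of_lt_of_le h1 h2
  · intro a _ b _ h
    exact YoungDiagram.ext h

/-- Young diagrams with `n` cells. -/
noncomputable def ydN (n : ℕ) : Finset YoungDiagram := (yd_finite n).toFinset

theorem mem_ydN {n : ℕ} {μ : YoungDiagram} : μ ∈ ydN n ↔ μ.card = n := by
  simp [ydN]

/-- Sum of contents. -/
def contSum (μ : YoungDiagram) : ℤ := ∑ b ∈ μ.cells, ((b.2 : ℤ) - b.1)

/-- Add a box at the end of row `i`. -/
def addBox (ν : YoungDiagram) (i : ℕ) (h : ∀ r < i, ν.rowLen i < ν.rowLen r) : YoungDiagram where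
  cells := insert (i, ν.rowLen i) ν.cells
  isLowerSet := by
    rintro ⟨a, b⟩ ⟨c, d⟩ hle hm
    simp only [Finset.coe_insert, Set.mem_insert_iff, Finset.mem_coe, YoungDiagram.mem_cells, Prod.mk.injEq] at hm ⊢
    obtain ⟨h1, h2⟩ := hle
    simp only at h1 h2
    rcases hm with ⟨rfl, rfl⟩ | hm
    · rcases Nat.lt_or_ge c a with hc | hc
      · right
        rw [YoungDiagram.mem_iff_lt_rowLen]
        exact lt_of_le_of_lt h2 (h c hc)
      · have : c = a := le_antisymm h1 hc
        subst this
        rcases Nat.lt_or_ge d (ν.rowLen c) with hd | hd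
        · right
          rwa [YoungDiagram.mem_iff_lt_rowLen]
        · left; exact ⟨rfl, le_antisymm h2 hd⟩
    · right; exact ν.up_left_mem h1 h2 hm

theorem addBox_notMem (ν : YoungDiagram) (i : ℕ) : (i, ν.rowLen i) ∉ ν.cells := by
  rw [YoungDiagram.mem_cells, YoungDiagram.mem_iff_lt_rowLen]; simp

theorem addBox_card (ν : YoungDiagram) (i : ℕ) (h) : (addBox ν i h).card = ν.card + 1 :=
  Finset.card_insert_of_notMem (addBox_notMem ν i)

theorem addBox_contSum (ν : YoungDiagram) (i : ℕ) (h) : contSum (addBox ν i h) - contSum ν = (ν.rowLen i : ℤ) - i := by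
  unfold contSum
  rw [show (addBox ν i h).cells = insert (i, ν.rowLen i) ν.cells from rfl, Finset.sum_insert (addBox_notMem ν i)]
  simp

theorem mem_addBox (ν : YoungDiagram) (i : ℕ) (h) (b : ℕ × ℕ) :
    b ∈ addBox ν i h ↔ b = (i, ν.rowLen i) ∨ b ∈ ν := by
  rw [← YoungDiagram.mem_cells, show (addBox ν i h).cells = insert (i, ν.rowLen i) ν.cells from rfl]
  simp

theorem addBox_rowLen (ν : YoungDiagram) (i : ℕ) (h) (r : ℕ) :
    (addBox ν i h).rowLen r = ν.rowLen r + if r = i then 1 else 0 := by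
  apply yd_rowLen_eq
  intro j
  rw [mem_addBox, YoungDiagram.mem_iff_lt_rowLen, Prod.mk.injEq]
  split_ifs with hr
  · subst hr; simp; omega
  · simp [hr]

theorem addBox_schur (ν : YoungDiagram) (i : Fin (ν.colLen 0 + 1)) (h) :
    schurPoly (addBox ν i h) = (jtM (rowData ν (ν.colLen 0 + 1) + Pi.single i 1)).det := by
  rw [schurPoly_pad _ (ν.colLen 0 + 1)]
  · congr 2
    ext r
    simp only [rowData, addBox_rowLen, Pi.add_apply, Pi.single_apply, Fin.ext_iff]
    split_ifs <;> simp
    ring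
  · by_contra hc
    push Not at hc
    rw [← YoungDiagram.mem_iff_lt_colLen, mem_addBox, YoungDiagram.mem_iff_lt_colLen, Prod.mk.injEq] at hc
    have := i.2
    omega

theorem exists_addBox (ν μ : YoungDiagram) (hle : ν ≤ μ) (hc : μ.card = ν.card + 1) :
    ∃ (i : ℕ) (h : _), i < ν.colLen 0 + 1 ∧ addBox ν i h = μ := by
  have hsub : ν.cells ⊆ μ.cells := YoungDiagram.cells_subset_iff.2 hle
  have h1 : (μ.cells \ ν.cells).card = 1 := by
    rw [Finset.card_sdiff_of_subset hsub]
    have : μ.cells.card = ν.cells.card + 1 := hc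
    omega
  obtain ⟨⟨r, s⟩, hb⟩ := Finset.card_eq_one.1 h1
  have key : ∀ b : ℕ × ℕ, (b ∈ μ ∧ b ∉ ν) ↔ b = (r, s) := by
    intro b
    rw [← Finset.mem_singleton, ← hb, Finset.mem_sdiff]
    rfl
  obtain ⟨hm, hn⟩ := (key (r, s)).2 rfl
  have hs : s = ν.rowLen r := by
    rw [YoungDiagram.mem_iff_lt_rowLen] at hn
    have := (key (r, ν.rowLen r)).1 ⟨μ.up_left_mem le_rfl (by omega) hm, by
      rw [YoungDiagram.mem_iff_lt_rowLen]; simp⟩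
    simpa using this.symm
  have hr : r < ν.colLen 0 + 1 := by
    by_contra hr
    have := (key (ν.colLen 0, 0)).1 ⟨μ.up_left_mem (by omega) (Nat.zero_le _) hm, by
      rw [YoungDiagram.mem_iff_lt_colLen]; simp⟩
    simp at this
    omega
  refine ⟨r, ?_, hr, ?_⟩
  · intro r' hr'
    by_contra hlt
    have := (key (r', s)).1 ⟨μ.up_left_mem hr'.le le_rfl hm, by
      rw [YoungDiagram.mem_iff_lt_rowLen]; omega⟩
    simp at this
    omega
  · apply YoungDiagram.ext
    change insert (r, ν.rowLen r) ν.cells = μ.cells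
    rw [← hs, Finset.insert_eq, ← hb, Finset.sdiff_union_of_subset hsub]

theorem sum_up (ν : YoungDiagram) (w : ℤ → ℂ) :
    ∑ μ ∈ (ydN (ν.card + 1)).filter (ν ≤ ·), w (contSum μ - contSum ν) • schurPoly μ =
    ∑ i, w (rowData ν (ν.colLen 0 + 1) i) • (jtM (rowData ν (ν.colLen 0 + 1) + Pi.single i 1)).det := by
  rw [← Finset.sum_filter_of_ne (p := fun i : Fin (ν.colLen 0 + 1) => ∀ r < (i : ℕ), ν.rowLen i < ν.rowLen r)]
  · symm
    refine Finset.sum_bij (fun i hi => addBox ν i (Finset.mem_filter.1 hi).2) ?_ ?_ ?_ ?_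
    · intro i hi
      rw [Finset.mem_filter, mem_ydN, addBox_card]
      refine ⟨rfl, ?_⟩
      rw [← YoungDiagram.cells_subset_iff]
      exact Finset.subset_insert _ _
    · intro i hi j hj hij
      have h1 : ((i : ℕ), ν.rowLen i) ∈ addBox ν j (Finset.mem_filter.1 hj).2 := by
        rw [← hij, mem_addBox]; left; rfl
      rw [mem_addBox] at h1
      rcases h1 with h1 | h1
      · rw [Prod.mk.injEq] at h1
        exact Fin.ext h1.1
      · exact absurd h1 (addBox_notMem ν i)
    · intro μ hμ
      rw [Finset.mem_filter, mem_ydN] at hμ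
      obtain ⟨i, h, hi, he⟩ := exists_addBox ν μ hμ.2 hμ.1
      exact ⟨⟨i, hi⟩, Finset.mem_filter.2 ⟨Finset.mem_univ _, h⟩, he⟩
    · intro i hi
      rw [addBox_contSum, addBox_schur]
      rfl
  · intro i _ hne
    by_contra hcon
    apply hne
    push Not at hcon
    obtain ⟨r, hr, hle⟩ := hcon
    obtain ⟨⟨k, hk⟩, rfl⟩ : ∃ k : Fin (ν.colLen 0), i = k.succ := by
      apply Fin.exists_succ_eq.2 _ |>.imp (fun _ h => h.symm)
      rintro rfl
      simp at hr
    simp only [Fin.succ_mk] at hr hle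
    have h1 := ν.rowLen_anti r k (by omega)
    have h2 := ν.rowLen_anti k (k+1) (by omega)
    have h3 : ν.rowLen k = ν.rowLen (k+1) := by omega
    rw [Matrix.det_zero_of_row_eq (i := ⟨k, by omega⟩) (j := ⟨k + 1, by omega⟩), smul_zero]
    · simp
    · ext j : 1
      simp only [jtM, rowData, Matrix.of_apply]
      congr 1
      simp [h3, rowData]
      ring

theorem last_rowData (ν : YoungDiagram) : rowData ν (ν.colLen 0 + 1) (Fin.last _) = -((ν.colLen 0 : ℕ) : ℤ) := by
  simp [rowData, yd_rowLen_zero le_rfl]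

theorem yd_pieri (ν : YoungDiagram) :
    ∑ μ ∈ (ydN (ν.card + 1)).filter (ν ≤ ·), schurPoly μ = MvPolynomial.X 0 * schurPoly ν := by
  have := sum_up ν (fun _ => 1)
  simp only [one_smul] at this
  rw [this, jt_pieri _ (last_rowData ν), schurPoly_pad ν (ν.colLen 0 + 1) (Nat.le_succ _)]

theorem yd_D (ν : YoungDiagram) :
    ∑ μ ∈ (ydN (ν.card + 1)).filter (ν ≤ ·), ((contSum μ - contSum ν : ℤ) : ℂ) • schurPoly μ = dD (schurPoly ν) := by
  have := sum_up ν (fun z => (z : ℂ))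
  rw [this, jt_D _ (last_rowData ν), schurPoly_pad ν (ν.colLen 0 + 1) (Nat.le_succ _)]

theorem exists_up (ν : YoungDiagram) : ∃ μ, ν ≤ μ ∧ μ.card = ν.card + 1 := by
  have h : ∀ r < ν.colLen 0, ν.rowLen (ν.colLen 0) < ν.rowLen r := by
    intro r hr
    rw [yd_rowLen_zero le_rfl, ← YoungDiagram.mem_iff_lt_rowLen, YoungDiagram.mem_iff_lt_colLen]
    exact hr
  refine ⟨addBox ν (ν.colLen 0) h, ?_, addBox_card _ _ _⟩
  rw [← YoungDiagram.cells_subset_iff]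
  exact Finset.subset_insert _ _

open scoped Classical

theorem std_mem {μ : YoungDiagram} {n : ℕ} {T : Fin n → ℕ × ℕ} (hT : IsStandardTableau μ n T) (k : Fin n) :
    T k ∈ μ := by
  have : T k ∈ (μ.cells : Set (ℕ × ℕ)) := by rw [← hT.2.1]; exact ⟨k, rfl⟩
  exact this

theorem std_exists {μ : YoungDiagram} {n : ℕ} {T : Fin n → ℕ × ℕ} (hT : IsStandardTableau μ n T)
    {b : ℕ × ℕ} (hb : b ∈ μ) : ∃ k, T k = b := by
  have : b ∈ Set.range T := by rw [hT.2.1]; exact hb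
  exact this

theorem std_mono {μ : YoungDiagram} {n : ℕ} {T : Fin n → ℕ × ℕ} (hT : IsStandardTableau μ n T)
    (d : ℕ) : ∀ j k : Fin n, (T j).1 ≤ (T k).1 → (T j).2 ≤ (T k).2 →
      ((T k).1 - (T j).1) + ((T k).2 - (T j).2) = d → j ≤ k := by
  induction d with
  | zero =>
    intro j k h1 h2 h3
    have : T j = T k := Prod.ext (by omega) (by omega)
    exact (hT.1 this).le
  | succ d ih =>
    intro j k h1 h2 h3
    by_cases h : (T j).2 < (T k).2
    · obtain ⟨m, hm⟩ := std_exists hT (b := ((T k).1, (T k).2 - 1))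
        (μ.up_left_mem le_rfl (Nat.sub_le _ _) (std_mem hT k))
      have e1 : (T m).1 = (T k).1 := by rw [hm]
      have e2 : (T m).2 = (T k).2 - 1 := by rw [hm]
      have hmk : m < k := hT.2.2 m k (by left; omega)
      exact (ih j m (by omega) (by omega) (by omega)).trans hmk.le
    · obtain ⟨m, hm⟩ := std_exists hT (b := ((T k).1 - 1, (T k).2))
        (μ.up_left_mem (Nat.sub_le _ _) le_rfl (std_mem hT k))
      have e1 : (T m).1 = (T k).1 - 1 := by rw [hm]
      have e2 : (T m).2 = (T k).2 := by rw [hm]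
      have hmk : m < k := hT.2.2 m k (by right; omega)
      exact (ih j m (by omega) (by omega) (by omega)).trans hmk.le

theorem std_le {μ : YoungDiagram} {n : ℕ} {T : Fin n → ℕ × ℕ} (hT : IsStandardTableau μ n T)
    {j k : Fin n} (h1 : (T j).1 ≤ (T k).1) (h2 : (T j).2 ≤ (T k).2) : j ≤ k :=
  std_mono hT _ j k h1 h2 rfl

/-- Content of the box containing entry `k`. -/
def tcont {n : ℕ} (T : Fin n → ℕ × ℕ) (k : Fin n) : ℤ := ((T k).2 : ℤ) - (T k).1

theorem tcont_ne {μ : YoungDiagram} {n : ℕ} {T : Fin n → ℕ × ℕ} (hT : IsStandardTableau μ n T)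
    {p q : Fin n} (hpq : (q : ℕ) = p + 1) : tcont T q ≠ tcont T p := by
  intro h
  unfold tcont at h
  rcases lt_trichotomy (T p).1 (T q).1 with hlt | heq | hgt
  · obtain ⟨m, hm⟩ := std_exists hT (b := ((T p).1, (T p).2 + 1))
      (μ.up_left_mem hlt.le (by omega) (std_mem hT q))
    have e1 : (T m).1 = (T p).1 := by rw [hm]
    have e2 : (T m).2 = (T p).2 + 1 := by rw [hm]
    have h1 : p < m := hT.2.2 p m (by left; omega)
    have h2 : m ≤ q := std_le hT (by omega) (by omega)
    have h3 : m ≠ q := by rintro rfl; omega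
    have : m < q := lt_of_le_of_ne h2 h3
    rw [Fin.lt_def] at *
    omega
  · have : T p = T q := Prod.ext heq (by omega)
    have := hT.1 this
    rw [Fin.ext_iff] at this
    omega
  · have : q ≤ p := std_le hT (by omega) (by omega)
    rw [Fin.le_def] at this
    omega

theorem tcont_zero {μ : YoungDiagram} {n : ℕ} {T : Fin n → ℕ × ℕ} (hT : IsStandardTableau μ n T)
    {p : Fin n} (hp : (p : ℕ) = 0) : tcont T p = 0 := by
  obtain ⟨m, hm⟩ := std_exists hT (b := (0, 0))
      (μ.up_left_mem (Nat.zero_le _) (Nat.zero_le _) (std_mem hT p))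
  have : m ≤ p := std_le hT (by rw [hm]; simp) (by rw [hm]; simp)
  have : m = p := by
    rw [Fin.le_def] at this
    apply Fin.ext; omega
  unfold tcont
  rw [← this, hm]; simp

theorem perm_adj_induction {n : ℕ} (P : Equiv.Perm (Fin n) → Prop) (h1 : P 1)
    (hmul : ∀ g h, P g → P h → P (g * h))
    (hadj : ∀ p q : Fin n, (q : ℕ) = p + 1 → P (Equiv.swap p q)) (g : Equiv.Perm (Fin n)) : P g := by
  rcases n with _ | n
  · rw [Subsingleton.elim g 1]; exact h1
  · have : g ∈ Submonoid.closure (Set.range fun i : Fin n ↦ Equiv.swap i.castSucc i.succ) := by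
      rw [Equiv.Perm.mclosure_swap_castSucc_succ]; trivial
    induction this using Submonoid.closure_induction with
    | mem x hx =>
      obtain ⟨i, rfl⟩ := hx
      exact hadj _ _ (by simp)
    | one => exact h1
    | mul x y _ _ hx hy => exact hmul _ _ hx hy

/-- Diagonal operator of contents. -/
noncomputable def contOp (μ : YoungDiagram) (n : ℕ) (k : Fin n) : Module.End ℂ (YoungSpace μ n) where
  toFun f := fun S => (tcont S.val k : ℂ) * f S
  map_add' f g := by funext S; simp; ring
  map_smul' c f := by funext S; simp; ring

theorem contOp_apply (μ : YoungDiagram) (n : ℕ) (k : Fin n) (f : YoungSpace μ n) (S) :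
    contOp μ n k f S = (tcont S.val k : ℂ) * f S := rfl

theorem youngOp_apply (μ : YoungDiagram) (n : ℕ) (p q : Fin n) (f : YoungSpace μ n) (S) :
    youngOp μ n p q f S = (rhoCoef p q S.val : ℂ) * f S +
      ((Real.sqrt (1 - (rhoCoef p q S.val) ^ 2) : ℝ) : ℂ) *
        (if h : IsStandardTableau μ n (S.val ∘ Equiv.swap p q) then
          f ⟨S.val ∘ Equiv.swap p q, h⟩ else 0) := rfl

theorem cont_young (μ : YoungDiagram) (n : ℕ) (p q : Fin n) (hpq : (q : ℕ) = p + 1) :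
    contOp μ n q * youngOp μ n p q = youngOp μ n p q * contOp μ n p + 1 := by
  apply LinearMap.ext
  intro f
  funext S
  simp only [Module.End.mul_apply, LinearMap.add_apply, Pi.add_apply, Module.End.one_apply,
    contOp_apply, youngOp_apply]
  have h1 : (rhoCoef p q S.val : ℂ) * ((tcont S.val q : ℂ) - (tcont S.val p : ℂ)) = 1 := by
    have h2 : rhoCoef p q S.val = (((tcont S.val q - tcont S.val p : ℤ) : ℝ))⁻¹ := by
      unfold rhoCoef tcont
      push_cast; rfl
    have h3 : ((tcont S.val q - tcont S.val p : ℤ) : ℂ) ≠ 0 := by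
      exact_mod_cast sub_ne_zero.2 (tcont_ne S.2 hpq)
    rw [h2, ← Int.cast_sub]
    push_cast at h3 ⊢
    exact inv_mul_cancel₀ h3
  have h4 : tcont (S.val ∘ Equiv.swap p q) p = tcont S.val q := by
    simp [tcont]
  split_ifs with h
  · simp only [h4]
    linear_combination (f S) * h1
  · linear_combination (f S) * h1

theorem jm_action {μ : YoungDiagram} {n : ℕ} {R : Representation ℂ (Equiv.Perm (Fin n)) (YoungSpace μ n)}
    (hR : IsYoungOrthogonalRep μ n R) (k : ℕ) : ∀ q : Fin n, (q : ℕ) = k →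
    ∑ i ∈ Finset.Iio q, R (Equiv.swap i q) = contOp μ n q := by
  induction k with
  | zero =>
    intro q hq
    have : Finset.Iio q = ∅ := by
      ext i; simp [Fin.le_def, hq]
    rw [this, Finset.sum_empty]
    apply LinearMap.ext
    intro f
    funext S
    rw [contOp_apply, tcont_zero S.2 hq]
    simp
  | succ k ih =>
    intro q hq
    have hq2 := q.2
    obtain ⟨p, hp⟩ : ∃ p : Fin n, (p : ℕ) = k := ⟨⟨k, by omega⟩, rfl⟩
    have hpq : (q : ℕ) = p + 1 := by omega
    have hI : Finset.Iio q = insert p (Finset.Iio p) := by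
      ext i
      simp only [Finset.mem_Iio, Finset.mem_insert, Fin.lt_def, Fin.ext_iff]
      omega
    have hsw : ∀ i ∈ Finset.Iio p, R (Equiv.swap i q) = R (Equiv.swap p q) * R (Equiv.swap i p) * R (Equiv.swap p q) := by
      intro i hi
      rw [Finset.mem_Iio, Fin.lt_def] at hi
      rw [← map_mul, ← map_mul]
      congr 1
      have h1 : i ≠ p := by rw [Ne, Fin.ext_iff]; omega
      have h2 : i ≠ q := by rw [Ne, Fin.ext_iff]; omega
      have := Equiv.mul_swap_eq_swap_mul (Equiv.swap p q) i p
      rw [this, Equiv.swap_apply_of_ne_of_ne h1 h2, Equiv.swap_apply_left, mul_assoc, Equiv.swap_mul_self, mul_one]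
    have hss : R (Equiv.swap p q) * R (Equiv.swap p q) = 1 := by
      rw [← map_mul, Equiv.swap_mul_self, map_one]
    rw [hI, Finset.sum_insert (by simp), Finset.sum_congr rfl hsw, ← Finset.sum_mul, ← Finset.mul_sum, ih p hp]
    have hc := cont_young μ n p q hpq
    rw [← hR p q hpq] at hc
    calc _ = (R (Equiv.swap p q) * contOp μ n p + 1) * R (Equiv.swap p q) := by
            rw [add_mul, one_mul, add_comm]
      _ = _ := by rw [← hc, mul_assoc, hss, mul_one]

/-- Embedding of symmetric groups fixing the last point. -/
def permUp (n : ℕ) : Equiv.Perm (Fin n) →* Equiv.Perm (Fin (n+1)) :=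
  Equiv.Perm.extendDomainHom (finSuccAboveEquiv (Fin.last n))

theorem permUp_castSucc {n : ℕ} (g : Equiv.Perm (Fin n)) (i : Fin n) :
    permUp n g i.castSucc = (g i).castSucc := by
  have := Equiv.Perm.extendDomain_apply_image g (finSuccAboveEquiv (Fin.last n)) i
  simp only [finSuccAboveEquiv_apply, Fin.succAbove_last] at this
  exact this

theorem permUp_last {n : ℕ} (g : Equiv.Perm (Fin n)) :
    permUp n g (Fin.last n) = Fin.last n := 
  Equiv.Perm.extendDomain_apply_not_subtype g (finSuccAboveEquiv (Fin.last n)) (by simp)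

theorem permUp_swap {n : ℕ} (p q : Fin n) :
    permUp n (Equiv.swap p q) = Equiv.swap p.castSucc q.castSucc := by
  ext x : 1
  induction x using Fin.lastCases with
  | last =>
    rw [permUp_last, Equiv.swap_apply_of_ne_of_ne] <;> exact (Fin.castSucc_lt_last _).ne'
  | cast i =>
    rw [permUp_castSucc, Equiv.swap_apply_def, Equiv.swap_apply_def]
    simp only [Fin.castSucc_inj]
    split_ifs <;> rfl

open scoped Classical

/-- Append a box with the largest entry. -/
def tsnoc {n : ℕ} (S : Fin n → ℕ × ℕ) (b : ℕ × ℕ) : Fin (n+1) → ℕ × ℕ :=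
  Fin.snoc (α := fun _ => ℕ × ℕ) S b

@[simp] theorem tsnoc_castSucc {n : ℕ} (S : Fin n → ℕ × ℕ) (b) (i : Fin n) : tsnoc S b i.castSucc = S i :=
  Fin.snoc_castSucc (α := fun _ => ℕ × ℕ) _ _ _

@[simp] theorem tsnoc_last {n : ℕ} (S : Fin n → ℕ × ℕ) (b) : tsnoc S b (Fin.last n) = b :=
  Fin.snoc_last (α := fun _ => ℕ × ℕ) _ _

theorem tsnoc_self {n : ℕ} (T : Fin (n+1) → ℕ × ℕ) : tsnoc (fun i => T i.castSucc) (T (Fin.last n)) = T := by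
  funext x
  induction x using Fin.lastCases with
  | last => simp
  | cast i => simp

theorem tsnoc_swap {n : ℕ} (S : Fin n → ℕ × ℕ) (b) (p q : Fin n) :
    tsnoc S b ∘ Equiv.swap p.castSucc q.castSucc = tsnoc (S ∘ Equiv.swap p q) b := by
  funext x
  induction x using Fin.lastCases with
  | last => rw [← permUp_swap]; simp [permUp_last]
  | cast i => rw [← permUp_swap]; simp [permUp_castSucc]

theorem tsnoc_std {μ ν : YoungDiagram} {b : ℕ × ℕ} (hb : b ∉ ν.cells) (hμ : μ.cells = insert b ν.cells)
    {n : ℕ} (S : Fin n → ℕ × ℕ) : IsStandardTableau μ (n+1) (tsnoc S b) ↔ IsStandardTableau ν n S := by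
  constructor
  · rintro ⟨hi, hr, ho⟩
    refine ⟨?_, ?_, ?_⟩
    · intro i j hij
      have := @hi i.castSucc j.castSucc (by simpa using hij)
      exact Fin.castSucc_injective _ this
    · ext x
      constructor
      · rintro ⟨i, rfl⟩
        have h1 : S i ∈ (μ.cells : Set (ℕ × ℕ)) := by rw [← hr]; exact ⟨i.castSucc, by simp⟩
        rw [hμ, Finset.mem_coe, Finset.mem_insert] at h1
        rcases h1 with h1 | h1
        · have := @hi i.castSucc (Fin.last n) (by simpa using h1)
          exact absurd this (Fin.castSucc_lt_last _).ne
        · exact h1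
      · intro hx
        have h1 : x ∈ Set.range (tsnoc S b) := by
          rw [hr, hμ, Finset.mem_coe, Finset.mem_insert]; right; exact hx
        obtain ⟨k, rfl⟩ := h1
        induction k using Fin.lastCases with
        | last => rw [tsnoc_last] at hx; exact absurd hx hb
        | cast i => exact ⟨i, by simp⟩
    · intro j k h
      have := ho j.castSucc k.castSucc (by simpa using h)
      simpa using this
  · rintro ⟨hi, hr, ho⟩
    have hS : ∀ i, S i ∈ ν := by
      intro i
      have : S i ∈ (ν.cells : Set (ℕ × ℕ)) := by rw [← hr]; exact ⟨i, rfl⟩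
      exact this
    refine ⟨?_, ?_, ?_⟩
    · intro i j
      induction i using Fin.lastCases with
      | last =>
        induction j using Fin.lastCases with
        | last => simp
        | cast j =>
          intro h
          simp only [tsnoc_last, tsnoc_castSucc] at h
          exact absurd (h ▸ hS j) hb
      | cast i =>
        induction j using Fin.lastCases with
        | last =>
          intro h
          simp only [tsnoc_last, tsnoc_castSucc] at h
          exact absurd (h ▸ hS i) hb
        | cast j =>
          intro h
          simp only [tsnoc_castSucc] at h
          rw [hi h]
    · ext x
      rw [hμ, Finset.mem_coe, Finset.mem_insert]
      constructor
      · rintro ⟨k, rfl⟩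
        induction k using Fin.lastCases with
        | last => left; simp
        | cast i => right; rw [tsnoc_castSucc]; exact hS i
      · rintro (rfl | hx)
        · exact ⟨Fin.last n, by simp⟩
        · have : x ∈ Set.range S := by rw [hr]; exact hx
          obtain ⟨i, rfl⟩ := this
          exact ⟨i.castSucc, by simp⟩
    · intro j k
      induction k using Fin.lastCases with
      | last =>
        induction j using Fin.lastCases with
        | last => simp
        | cast j => intro _; exact Fin.castSucc_lt_last _
      | cast k =>
        induction j using Fin.lastCases with
        | last =>
          simp only [tsnoc_last, tsnoc_castSucc]
          intro h
          exfalso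
          apply hb
          have := hS k
          exact ν.up_left_mem (i1 := b.1) (j1 := b.2) (i2 := (S k).1) (j2 := (S k).2) (by omega) (by omega) this
        | cast j =>
          simp only [tsnoc_castSucc, Fin.castSucc_lt_castSucc_iff]
          exact ho j k

section
variable {μ ν : YoungDiagram} {b : ℕ × ℕ} (hb : b ∉ ν.cells) (hμ : μ.cells = insert b ν.cells) {n : ℕ}

/-- Extend a tableau. -/
def tabExt (S : {T : Fin n → ℕ × ℕ // IsStandardTableau ν n T}) :
    {T : Fin (n+1) → ℕ × ℕ // IsStandardTableau μ (n+1) T} :=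
  ⟨tsnoc S.val b, (tsnoc_std hb hμ _).2 S.2⟩

theorem tabExt_injective : Function.Injective (tabExt hb hμ (n := n)) := by
  intro S S' h
  have h1 : tsnoc S.val b = tsnoc S'.val b := congrArg Subtype.val h
  apply Subtype.ext
  funext i
  have := congrFun h1 i.castSucc
  simpa using this

/-- Restriction map. -/
noncomputable def yRes : YoungSpace μ (n+1) →ₗ[ℂ] YoungSpace ν n :=
  LinearMap.funLeft ℂ ℂ (tabExt hb hμ (n := n))

theorem yRes_apply (f : YoungSpace μ (n+1)) (S) : yRes hb hμ f S = f (tabExt hb hμ S) := rfl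

theorem yRes_surj : Function.Surjective (yRes hb hμ (n := n)) :=
  LinearMap.funLeft_surjective_of_injective ℂ ℂ _ (tabExt_injective hb hμ)

theorem yRes_youngOp (p q : Fin n) (f : YoungSpace μ (n+1)) :
    yRes hb hμ (youngOp μ (n+1) p.castSucc q.castSucc f) = youngOp ν n p q (yRes hb hμ f) := by
  funext S
  rw [yRes_apply, youngOp_apply, youngOp_apply, yRes_apply]
  have h1 : rhoCoef p.castSucc q.castSucc (tabExt hb hμ S).val = rhoCoef p q S.val := by
    simp [rhoCoef, tabExt]
  rw [h1]
  congr 2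
  have h2 : (tabExt hb hμ S).val ∘ Equiv.swap p.castSucc q.castSucc = tsnoc (S.val ∘ Equiv.swap p q) b :=
    tsnoc_swap _ _ _ _
  simp only [h2]
  by_cases h : IsStandardTableau ν n (S.val ∘ Equiv.swap p q)
  · rw [dif_pos h, dif_pos ((tsnoc_std hb hμ _).2 h), yRes_apply]
    rfl
  · rw [dif_neg h, dif_neg (mt (tsnoc_std hb hμ _).1 h)]

variable {R : Representation ℂ (Equiv.Perm (Fin (n+1))) (YoungSpace μ (n+1))}

theorem yRes_adj (hR : IsYoungOrthogonalRep μ (n+1) R) (p q : Fin n) (hpq : (q : ℕ) = p + 1) (f : YoungSpace μ (n+1)) :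
    yRes hb hμ (R (permUp n (Equiv.swap p q)) f) = youngOp ν n p q (yRes hb hμ f) := by
  rw [permUp_swap, hR p.castSucc q.castSucc (by simpa using hpq), yRes_youngOp]

theorem yRes_intertwine (hR : IsYoungOrthogonalRep μ (n+1) R) {Q : Representation ℂ (Equiv.Perm (Fin n)) (YoungSpace ν n)}
    (hQ : IsYoungOrthogonalRep ν n Q) (g : Equiv.Perm (Fin n)) :
    ∀ f : YoungSpace μ (n+1), yRes hb hμ (R (permUp n g) f) = Q g (yRes hb hμ f) := by
  induction g using perm_adj_induction with
  | h1 => intro f; simp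
  | hmul g h hg hh => intro f; simp [hg, hh]
  | hadj p q hpq =>
    intro f
    rw [yRes_adj hb hμ hR p q hpq, hQ p q hpq]

theorem yRes_ker (hR : IsYoungOrthogonalRep μ (n+1) R) (g : Equiv.Perm (Fin n)) :
    ∀ f : YoungSpace μ (n+1), yRes hb hμ f = 0 → yRes hb hμ (R (permUp n g) f) = 0 := by
  induction g using perm_adj_induction with
  | h1 => intro f; simp
  | hmul g h hg hh =>
    intro f hf
    rw [map_mul, map_mul, Module.End.mul_apply]
    exact hg _ (hh _ hf)
  | hadj p q hpq =>
    intro f hf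
    rw [yRes_adj hb hμ hR p q hpq, hf, map_zero]

theorem exists_yRes_rep (hb : b ∉ ν.cells) (hμ : μ.cells = insert b ν.cells) (hR : IsYoungOrthogonalRep μ (n+1) R) : ∃ Q : Representation ℂ (Equiv.Perm (Fin n)) (YoungSpace ν n),
    IsYoungOrthogonalRep ν n Q := by
  obtain ⟨j, hj⟩ := LinearMap.exists_rightInverse_of_surjective (yRes hb hμ (n := n))
    (LinearMap.range_eq_top.2 (yRes_surj hb hμ))
  have hj' : ∀ f, yRes hb hμ (j f) = f := fun f => LinearMap.congr_fun hj f
  have key : ∀ g f, yRes hb hμ (R (permUp n g) (j (yRes hb hμ f))) = yRes hb hμ (R (permUp n g) f) := by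
    intro g f
    rw [← sub_eq_zero, ← map_sub, ← map_sub]
    apply yRes_ker hb hμ hR
    rw [map_sub, hj', sub_self]
  refine ⟨{ toFun := fun g => yRes hb hμ ∘ₗ R (permUp n g) ∘ₗ j, map_one' := ?_, map_mul' := ?_ }, ?_⟩
  · apply LinearMap.ext; intro f
    simp [hj']
  · intro g h
    apply LinearMap.ext; intro f
    simp only [LinearMap.comp_apply, Module.End.mul_apply, map_mul, key]
  · intro p q hpq
    apply LinearMap.ext; intro f
    change yRes hb hμ (R (permUp n (Equiv.swap p q)) (j f)) = _
    rw [yRes_adj hb hμ hR p q hpq, hj']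
end

instance tabFinite (μ : YoungDiagram) (n : ℕ) : Finite {T : Fin n → ℕ × ℕ // IsStandardTableau μ n T} := by
  apply Finite.of_injective (β := Fin n → μ.cells)
    (fun T => fun i => ⟨T.val i, std_mem T.2 i⟩)
  intro T T' h
  apply Subtype.ext
  funext i
  have := congrFun h i
  simpa using this

noncomputable instance tabFintype (μ : YoungDiagram) (n : ℕ) : Fintype {T : Fin n → ℕ × ℕ // IsStandardTableau μ n T} :=
  Fintype.ofFinite _

theorem trace_sum {ι : Type*} [Fintype ι] [DecidableEq ι] (A : Module.End ℂ (ι → ℂ)) :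
    LinearMap.trace ℂ (ι → ℂ) A = ∑ i, A (Pi.single i 1) i := by
  rw [LinearMap.trace_eq_matrix_trace ℂ (Pi.basisFun ℂ ι), Matrix.trace]
  apply Finset.sum_congr rfl
  intro i _
  rw [Matrix.diag_apply, LinearMap.toMatrix_apply]
  simp

/-- Shape of a tableau with largest entry removed. -/
def downShape {μ : YoungDiagram} {n : ℕ} (T : {T : Fin (n+1) → ℕ × ℕ // IsStandardTableau μ (n+1) T}) :
    YoungDiagram where
  cells := μ.cells.erase (T.val (Fin.last n))
  isLowerSet := by
    rintro x y hyx hx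
    simp only [Finset.coe_erase, Set.mem_sdiff, Finset.mem_coe, Set.mem_singleton_iff] at hx ⊢
    refine ⟨μ.isLowerSet hyx hx.1, ?_⟩
    rintro rfl
    obtain ⟨k, rfl⟩ := std_exists T.2 hx.1
    have : Fin.last n ≤ k := std_le T.2 hyx.1 hyx.2
    exact hx.2 (by rw [Fin.last_le_iff.1 this])

theorem downShape_insert {μ : YoungDiagram} {n : ℕ} (T : {T : Fin (n+1) → ℕ × ℕ // IsStandardTableau μ (n+1) T}) :
    T.val (Fin.last n) ∉ (downShape T).cells ∧ μ.cells = insert (T.val (Fin.last n)) (downShape T).cells := by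
  have : (downShape T).cells = μ.cells.erase (T.val (Fin.last n)) := rfl
  rw [this]
  exact ⟨by simp, (Finset.insert_erase (std_mem T.2 _)).symm⟩

theorem downShape_cont {μ : YoungDiagram} {n : ℕ} (T : {T : Fin (n+1) → ℕ × ℕ // IsStandardTableau μ (n+1) T}) :
    tcont T.val (Fin.last n) = contSum μ - contSum (downShape T) := by
  obtain ⟨h1, h2⟩ := downShape_insert T
  unfold contSum
  rw [h2, Finset.sum_insert h1]
  unfold tcont
  ring

theorem sum_downShape {μ ν : YoungDiagram} {b : ℕ × ℕ} (hb : b ∉ ν.cells) (hμ : μ.cells = insert b ν.cells) {n : ℕ}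
    (φ : {T : Fin (n+1) → ℕ × ℕ // IsStandardTableau μ (n+1) T} → ℂ) :
    ∑ T ∈ Finset.univ.filter (fun T => downShape T = ν), φ T =
      ∑ S : {T : Fin n → ℕ × ℕ // IsStandardTableau ν n T}, φ (tabExt hb hμ S) := by
  symm
  refine Finset.sum_bij (fun S _ => tabExt hb hμ S) ?_ ?_ ?_ ?_
  · intro S _
    rw [Finset.mem_filter]
    refine ⟨Finset.mem_univ _, ?_⟩
    apply YoungDiagram.ext
    change μ.cells.erase (tsnoc S.val b (Fin.last n)) = ν.cells
    rw [tsnoc_last, hμ, Finset.erase_insert hb]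
  · intro S _ S' _ h
    exact tabExt_injective hb hμ h
  · intro T hT
    obtain ⟨-, rfl⟩ := Finset.mem_filter.1 hT
    obtain ⟨h1, h2⟩ := downShape_insert T
    have hTb : T.val (Fin.last n) = b := by
      have h3 : b ∈ insert (T.val (Fin.last n)) (downShape T).cells := by
        rw [← h2, hμ]; exact Finset.mem_insert_self _ _
      rw [Finset.mem_insert] at h3
      exact (h3.resolve_right hb).symm
    have h4 : tsnoc (fun i => T.val i.castSucc) b = T.val := by
      rw [← hTb]; exact tsnoc_self _
    refine ⟨⟨fun i => T.val i.castSucc, ?_⟩, Finset.mem_univ _, ?_⟩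
    · rw [← tsnoc_std hb hμ, h4]; exact T.2
    · exact Subtype.ext h4
  · intro S _; rfl

theorem trace_down {μ : YoungDiagram} {n : ℕ} (hμn : μ.card = n + 1)
    {R : Representation ℂ (Equiv.Perm (Fin (n+1))) (YoungSpace μ (n+1))}
    (hR : IsYoungOrthogonalRep μ (n+1) R)
    (Q : ∀ ν : YoungDiagram, Representation ℂ (Equiv.Perm (Fin n)) (YoungSpace ν n))
    (hQ : ∀ ν : YoungDiagram, ν.card = n → IsYoungOrthogonalRep ν n (Q ν))
    (g : Equiv.Perm (Fin n)) (w : ℤ → ℂ) :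
    ∑ T : {T : Fin (n+1) → ℕ × ℕ // IsStandardTableau μ (n+1) T},
      w (tcont T.val (Fin.last n)) * R (permUp n g) (Pi.single T 1) T =
    ∑ ν ∈ (ydN n).filter (· ≤ μ), w (contSum μ - contSum ν) * LinearMap.trace ℂ _ (Q ν g) := by
  rw [← Finset.sum_fiberwise_of_maps_to (t := (ydN n).filter (· ≤ μ)) (g := downShape)]
  · apply Finset.sum_congr rfl
    intro ν hν
    rw [Finset.mem_filter, mem_ydN] at hν
    obtain ⟨i, h, -, he⟩ := exists_addBox ν μ hν.2 (by rw [hμn, hν.1])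
    have hb := addBox_notMem ν i
    have hμ : μ.cells = insert (i, ν.rowLen i) ν.cells := by rw [← he]; rfl
    rw [trace_sum, Finset.mul_sum, Finset.sum_congr rfl (g := fun T =>
      w (contSum μ - contSum ν) * R (permUp n g) (Pi.single T 1) T)]
    · rw [sum_downShape hb hμ]
      apply Finset.sum_congr rfl
      intro S _
      congr 1
      rw [← yRes_apply hb hμ (R (permUp n g) (Pi.single (tabExt hb hμ S) 1)) S, yRes_intertwine hb hμ hR (hQ ν hν.1)]
      have hsing : yRes hb hμ (Pi.single (tabExt hb hμ S) 1) = Pi.single S 1 := by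
        funext S'
        rw [yRes_apply]
        simp only [Pi.single_apply, (tabExt_injective hb hμ).eq_iff]
      rw [hsing]
    · intro T hT
      rw [downShape_cont, (Finset.mem_filter.1 hT).2]
  · intro T _
    obtain ⟨h1, h2⟩ := downShape_insert T
    rw [Finset.mem_filter, mem_ydN]
    constructor
    · have := Finset.card_insert_of_notMem h1
      rw [← h2] at this
      have h3 : μ.cells.card = n + 1 := hμn
      change (downShape T).cells.card = n
      omega
    · rw [← YoungDiagram.cells_subset_iff]
      exact Finset.erase_subset _ _

open scoped Classical
open Equiv.Perm in
/-- Length of the cycle through `j`. -/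
noncomputable def clen {n : ℕ} (g : Equiv.Perm (Fin n)) (j : Fin n) : ℕ :=
  if g j = j then 1 else (g.cycleOf j).support.card

theorem parts_eq {n : ℕ} (g : Equiv.Perm (Fin n)) :
    g.partition.parts = g.cycleType + Multiset.replicate (n - g.cycleType.sum) 1 := by
  rw [Equiv.Perm.parts_partition, Equiv.Perm.sum_cycleType, Fintype.card_fin]

theorem sum_ct_le {n : ℕ} (g : Equiv.Perm (Fin n)) : g.cycleType.sum ≤ n := by
  rw [Equiv.Perm.sum_cycleType]
  simpa using Finset.card_le_univ g.support

theorem parts_permUp {n : ℕ} (c : Equiv.Perm (Fin n)) :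
    (permUp n c).partition.parts = {1} + c.partition.parts := by
  have h : (permUp n c).cycleType = c.cycleType := by
    unfold permUp
    exact Equiv.Perm.cycleType_extendDomain _
  rw [parts_eq, parts_eq, h]
  have := sum_ct_le c
  rw [show n + 1 - c.cycleType.sum = (n - c.cycleType.sum) + 1 by omega, Multiset.replicate_add,
    Multiset.replicate_one]
  abel

theorem sum_clen {M : Type*} [AddCommMonoid M] {n : ℕ} (g : Equiv.Perm (Fin n)) (F : ℕ → M) :
    ∑ j, F (clen g j) = (g.partition.parts.map (fun r => r • F r)).sum := by
  rw [Equiv.Perm.parts_partition, Multiset.map_add, Multiset.sum_add, Multiset.map_replicate,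
    Multiset.sum_replicate, one_smul, Equiv.Perm.cycleType_def, Multiset.map_map]
  have h1 := (Finset.sum_add_sum_compl g.support (fun j => F (clen g j))).symm
  rw [h1]
  congr 1
  · have h2 : ∀ j ∈ g.support, F (clen g j) = F (g.cycleOf j).support.card := by
      intro j hj
      rw [clen, if_neg (Equiv.Perm.mem_support.1 hj)]
    rw [Finset.sum_congr rfl h2]
    rw [← Finset.sum_fiberwise_of_maps_to (t := g.cycleFactorsFinset) (g := fun j => g.cycleOf j)
      (fun j hj => Equiv.Perm.cycleOf_mem_cycleFactorsFinset_iff.2 hj)]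
    change _ = ∑ σ ∈ g.cycleFactorsFinset, _
    apply Finset.sum_congr rfl
    intro σ hσ
    have h3 : g.support.filter (fun j => g.cycleOf j = σ) = σ.support := by
      ext j
      rw [Finset.mem_filter]
      constructor
      · rintro ⟨h4, rfl⟩
        rw [Equiv.Perm.mem_support, Equiv.Perm.cycleOf_apply_self]
        exact Equiv.Perm.mem_support.1 h4
      · intro h4
        refine ⟨Equiv.Perm.mem_cycleFactorsFinset_support_le hσ h4, ?_⟩
        exact (Equiv.Perm.cycle_is_cycleOf h4 hσ).symm
    rw [Finset.sum_congr h3 (g := fun _ => F σ.support.card)]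
    · simp
    · intro j hj
      rw [← h3] at hj
      rw [(Finset.mem_filter.1 hj).2]
  · rw [Finset.sum_congr rfl (g := fun _ => F 1)]
    · rw [Finset.sum_const, Finset.card_compl]
    · intro j hj
      rw [Finset.mem_compl, Equiv.Perm.mem_support, not_not] at hj
      rw [clen, if_pos hj]

theorem ct_swap {n : ℕ} (g : Equiv.Perm (Fin n)) (a j : Fin n) (ha : g a = a) (haj : a ≠ j) (hj : g j ≠ j) :
    ∃ s : Multiset ℕ, g.cycleType = {clen g j} + s ∧ (Equiv.swap a j * g).cycleType = {clen g j + 1} + s := by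
  have hmem : g.cycleOf j ∈ g.cycleFactorsFinset :=
    Equiv.Perm.cycleOf_mem_cycleFactorsFinset_iff.2 (Equiv.Perm.mem_support.2 hj)
  have hd := (Equiv.Perm.disjoint_mul_inv_of_mem_cycleFactorsFinset hmem)
  set z := g.cycleOf j with hz
  set r := g * z⁻¹ with hr
  have hcomm := hd.commute
  have hg : g = z * r := by
    rw [← hcomm.eq, hr]; simp
  have hzc : z.IsCycle := Equiv.Perm.isCycle_cycleOf g hj
  have hcl : clen g j = z.support.card := by rw [clen, if_neg hj]
  have hza : z a = a := by
    rw [hz]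
    apply Equiv.Perm.cycleOf_apply_of_not_sameCycle
    intro h
    exact hj ((h.apply_eq_self_iff).2 ha)
  have hzj : z j ≠ j := by
    rw [hz, Equiv.Perm.cycleOf_apply_self]; exact hj
  have hra : r a = a := by
    have : z⁻¹ a = a := by rw [Equiv.Perm.inv_eq_iff_eq]; exact hza.symm
    rw [hr, Equiv.Perm.mul_apply, this, ha]
  have hrj : r j = j := (hd j).resolve_right hzj
  have hdz : (Equiv.swap a j * z).Disjoint r := by
    apply Equiv.Perm.Disjoint.mul_left
    · intro x
      by_cases h1 : x = a
      · right; rw [h1, hra]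
      · by_cases h2 : x = j
        · right; rw [h2, hrj]
        · left; exact Equiv.swap_apply_of_ne_of_ne h1 h2
    · exact hd.symm
  have hform : (Equiv.swap a j * z).cycleType = {z.support.card + 1} := by
    have hlen := Equiv.Perm.length_toList g j
    rw [← hz] at hlen
    have h2 := hzc.two_le_card_support
    obtain ⟨x, l, hl⟩ : ∃ x l, Equiv.Perm.toList g j = x :: l := by
      rcases h : Equiv.Perm.toList g j with _ | ⟨x, l⟩
      · rw [h] at hlen; simp at hlen; omega
      · exact ⟨x, l, rfl⟩
    have hx : x = j := by
      have := Equiv.Perm.toList_getElem_zero g j (Equiv.Perm.mem_support.2 hj)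
      simpa [hl] using this
    subst hx
    have h3 : Equiv.swap a x * z = (a :: x :: l).formPerm := by
      rw [List.formPerm_cons_cons, ← hl, Equiv.Perm.formPerm_toList]
    have h4 : (a :: x :: l).Nodup := by
      rw [← hl, List.nodup_cons]
      refine ⟨?_, Equiv.Perm.nodup_toList g x⟩
      rw [Equiv.Perm.mem_toList_iff]
      rintro ⟨h, -⟩
      exact hj ((h.apply_eq_self_iff).2 ha)
    rw [h3, (List.isCycle_formPerm h4 (by simp)).cycleType,
      List.support_formPerm_of_nodup _ h4 (by simp), List.toFinset_card_of_nodup h4,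
      List.length_cons, ← hl, hlen]
  refine ⟨r.cycleType, ?_, ?_⟩
  · conv_lhs => rw [hg]
    rw [hd.symm.cycleType_mul, hzc.cycleType, hcl]
  · conv_lhs => rw [hg, ← mul_assoc]
    rw [hdz.cycleType_mul, hform, hcl]

theorem parts_swap {n : ℕ} (g : Equiv.Perm (Fin n)) (a j : Fin n) (ha : g a = a) (haj : a ≠ j) :
    (Equiv.swap a j * g).partition.parts + {1} + {clen g j} = g.partition.parts + {clen g j + 1} := by
  rw [parts_eq, parts_eq]
  have hle1 := sum_ct_le (Equiv.swap a j * g)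
  have hle2 := sum_ct_le g
  by_cases hj : g j = j
  · have hd : (Equiv.swap a j).Disjoint g := by
      intro x
      by_cases h1 : x = a
      · right; rw [h1, ha]
      · by_cases h2 : x = j
        · right; rw [h2, hj]
        · left; exact Equiv.swap_apply_of_ne_of_ne h1 h2
    have hct : (Equiv.swap a j * g).cycleType = {2} + g.cycleType := by
      rw [hd.cycleType_mul, Equiv.Perm.isSwap_iff_cycleType.1 ⟨a, j, haj, rfl⟩]
    have hcl : clen g j = 1 := by rw [clen, if_pos hj]
    rw [hct] at hle1 ⊢
    rw [hcl]
    rw [Multiset.sum_add, Multiset.sum_singleton] at *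
    rw [show n - g.cycleType.sum = (n - (2 + g.cycleType.sum)) + 1 + 1 by omega, Multiset.replicate_add,
      Multiset.replicate_add, Multiset.replicate_one]
    abel
  · obtain ⟨s, h1, h2⟩ := ct_swap g a j ha haj hj
    rw [h2] at hle1 ⊢
    rw [h1] at hle2 ⊢
    rw [Multiset.sum_add, Multiset.sum_singleton] at *
    rw [Multiset.sum_add, Multiset.sum_singleton] at *
    rw [show n - (clen g j + s.sum) = (n - (clen g j + 1 + s.sum)) + 1 by omega, Multiset.replicate_add,
      Multiset.replicate_one]
    abel

theorem exists_perm_parts {n : ℕ} (s : Multiset ℕ) (hs : s.sum = n) (hpos : ∀ r ∈ s, 1 ≤ r) :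
    ∃ c : Equiv.Perm (Fin n), c.partition.parts = s := by
  have hsplit := Multiset.filter_add_not (fun r => 2 ≤ r) s
  have hone : s.filter (fun r => ¬ 2 ≤ r) = Multiset.replicate (Multiset.card (s.filter (fun r => ¬ 2 ≤ r))) 1 := by
    rw [Multiset.eq_replicate]
    refine ⟨rfl, ?_⟩
    intro r hr
    rw [Multiset.mem_filter] at hr
    have := hpos r hr.1
    omega
  have hsum : (s.filter (fun r => 2 ≤ r)).sum + Multiset.card (s.filter (fun r => ¬ 2 ≤ r)) = n := by
    rw [← hs]
    conv_rhs => rw [← hsplit, Multiset.sum_add, hone, Multiset.sum_replicate]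
    simp
  obtain ⟨c, hc⟩ := (Equiv.Perm.exists_with_cycleType_iff (Fin n) (m := s.filter (fun r => 2 ≤ r))).2
    ⟨by rw [Fintype.card_fin]; omega, fun r hr => (Multiset.mem_filter.1 hr).2⟩
  refine ⟨c, ?_⟩
  rw [parts_eq, hc, show n - (s.filter (fun r => 2 ≤ r)).sum = Multiset.card (s.filter (fun r => ¬ 2 ≤ r)) by omega,
    ← hone, hsplit]

/-- Power sum products. -/
noncomputable def pP (s : Multiset ℕ) : MvPolynomial ℕ ℂ :=
  (s.map fun r : ℕ => (r : ℂ) • (MvPolynomial.X (r - 1) : MvPolynomial ℕ ℂ)).prod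

theorem pP_add (s t : Multiset ℕ) : pP (s + t) = pP s * pP t := by
  simp [pP]

theorem pP_single (r : ℕ) : pP {r} = (r : ℂ) • (MvPolynomial.X (r - 1) : MvPolynomial ℕ ℂ) := by
  simp [pP]

theorem dD_pP_single {r : ℕ} (hr : 1 ≤ r) : dD (pP {r}) = r • pP {r + 1} := by
  obtain ⟨k, rfl⟩ := Nat.exists_eq_add_of_le' hr
  rw [pP_single, pP_single, Derivation.map_smul, dD_X, ← Nat.cast_smul_eq_nsmul ℂ]
  congr 1
  simp only [Nat.add_sub_cancel]
  congr 1
  push_cast; ring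

theorem dD_pP (s : Multiset ℕ) (hpos : ∀ r ∈ s, 1 ≤ r) :
    dD (pP s) = (s.map (fun r => r • pP (s.erase r + {r + 1}))).sum := by
  induction s using Multiset.induction_on with
  | empty => simp [pP]
  | cons a s ih =>
    have ha := hpos a (Multiset.mem_cons_self a s)
    have ih' := ih (fun r hr => hpos r (Multiset.mem_cons_of_mem hr))
    rw [← Multiset.singleton_add, pP_add, Derivation.leibniz, ih', dD_pP_single ha, Multiset.singleton_add,
      Multiset.map_cons, Multiset.sum_cons, Multiset.erase_cons_head, pP_add, add_comm]
    congr 1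
    · simp only [smul_eq_mul, nsmul_eq_mul]; ring
    · rw [smul_eq_mul, ← Multiset.sum_map_mul_left]
      congr 1
      apply Multiset.map_congr rfl
      intro r hr
      have : (a ::ₘ s).erase r = {a} + s.erase r := by
        rw [Multiset.singleton_add]
        by_cases h : r = a
        · subst h; rw [Multiset.erase_cons_head, Multiset.cons_erase hr]
        · rw [Multiset.erase_cons_tail _ (Ne.symm h)]
      rw [this, pP_add, pP_add, pP_add]
      simp only [nsmul_eq_mul]; ring

open scoped Classical

/-- The right-hand side of the Frobenius formula. -/
noncomputable def Phi {n : ℕ}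
    (F : ∀ μ : YoungDiagram, Representation ℂ (Equiv.Perm (Fin n)) (YoungSpace μ n))
    (g : Equiv.Perm (Fin n)) : MvPolynomial ℕ ℂ :=
  ∑ μ ∈ ydN n, LinearMap.trace ℂ (YoungSpace μ n) (F μ g) • schurPoly μ

theorem Phi_class {n : ℕ}
    (F : ∀ μ : YoungDiagram, Representation ℂ (Equiv.Perm (Fin n)) (YoungSpace μ n))
    (g h : Equiv.Perm (Fin n)) (hgh : g.partition.parts = h.partition.parts) : Phi F g = Phi F h := by
  have h1 : IsConj g h := Equiv.Perm.partition_eq_of_isConj.2 (Nat.Partition.ext hgh)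
  obtain ⟨c, hc⟩ := isConj_iff.1 h1
  unfold Phi
  apply Finset.sum_congr rfl
  intro μ _
  congr 1
  rw [← hc, map_mul, LinearMap.trace_mul_comm, ← map_mul]
  congr 2
  group

theorem exists_Q {n : ℕ}
    (F : ∀ μ : YoungDiagram, Representation ℂ (Equiv.Perm (Fin (n+1))) (YoungSpace μ (n+1)))
    (hF : ∀ μ : YoungDiagram, μ.card = n + 1 → IsYoungOrthogonalRep μ (n+1) (F μ)) :
    ∃ Q : ∀ ν : YoungDiagram, Representation ℂ (Equiv.Perm (Fin n)) (YoungSpace ν n),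
      ∀ ν : YoungDiagram, ν.card = n → IsYoungOrthogonalRep ν n (Q ν) := by
  have : ∀ ν : YoungDiagram, ∃ Q : Representation ℂ (Equiv.Perm (Fin n)) (YoungSpace ν n),
      ν.card = n → IsYoungOrthogonalRep ν n Q := by
    intro ν
    by_cases hν : ν.card = n
    · obtain ⟨μ, hle, hc⟩ := exists_up ν
      obtain ⟨i, h, -, rfl⟩ := exists_addBox ν μ hle hc
      obtain ⟨Q, hQ⟩ := exists_yRes_rep (addBox_notMem ν i) rfl (hF _ (by rw [hc, hν]))
      exact ⟨Q, fun _ => hQ⟩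
    · exact ⟨1, fun h => absurd h hν⟩
  choose Q hQ using this
  exact ⟨Q, hQ⟩

theorem sum_swap_yd {n : ℕ} (w : ℤ → ℂ) (t : YoungDiagram → ℂ) :
    ∑ μ ∈ ydN (n+1), (∑ ν ∈ (ydN n).filter (· ≤ μ), w (contSum μ - contSum ν) * t ν) • schurPoly μ =
    ∑ ν ∈ ydN n, t ν • ∑ μ ∈ (ydN (ν.card+1)).filter (ν ≤ ·), w (contSum μ - contSum ν) • schurPoly μ := by
  have h1 : ∀ μ, (∑ ν ∈ (ydN n).filter (· ≤ μ), w (contSum μ - contSum ν) * t ν) • schurPoly μ =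
      ∑ ν ∈ (ydN n).filter (· ≤ μ), t ν • w (contSum μ - contSum ν) • schurPoly μ := by
    intro μ
    rw [Finset.sum_smul]
    apply Finset.sum_congr rfl
    intro ν _
    rw [smul_smul, mul_comm]
  simp only [h1, Finset.smul_sum]
  apply Finset.sum_comm'
  intro μ ν
  simp only [Finset.mem_filter, mem_ydN]
  constructor
  · rintro ⟨h1, h2, h3⟩; exact ⟨⟨by omega, h3⟩, h2⟩
  · rintro ⟨⟨h1, h3⟩, h2⟩; exact ⟨by omega, h2, h3⟩

section
variable {n : ℕ}
    (F : ∀ μ : YoungDiagram, Representation ℂ (Equiv.Perm (Fin (n+1))) (YoungSpace μ (n+1)))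
    (hF : ∀ μ : YoungDiagram, μ.card = n + 1 → IsYoungOrthogonalRep μ (n+1) (F μ))
    (Q : ∀ ν : YoungDiagram, Representation ℂ (Equiv.Perm (Fin n)) (YoungSpace ν n))
    (hQ : ∀ ν : YoungDiagram, ν.card = n → IsYoungOrthogonalRep ν n (Q ν))
    (c : Equiv.Perm (Fin n))

theorem Phi_permUp 
    (hF : ∀ μ : YoungDiagram, μ.card = n + 1 → IsYoungOrthogonalRep μ (n+1) (F μ))
    (hQ : ∀ ν : YoungDiagram, ν.card = n → IsYoungOrthogonalRep ν n (Q ν)) :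
    Phi F (permUp n c) = MvPolynomial.X 0 * Phi Q c := by
  unfold Phi
  have h1 : ∀ μ ∈ ydN (n+1), LinearMap.trace ℂ (YoungSpace μ (n+1)) (F μ (permUp n c)) • schurPoly μ =
      (∑ ν ∈ (ydN n).filter (· ≤ μ), (fun _ : ℤ => (1:ℂ)) (contSum μ - contSum ν) *
        LinearMap.trace ℂ _ (Q ν c)) • schurPoly μ := by
    intro μ hμ
    rw [mem_ydN] at hμ
    rw [← trace_down hμ (hF μ hμ) Q hQ c (fun _ => 1), trace_sum]
    simp only [one_mul]
  rw [Finset.sum_congr rfl h1, sum_swap_yd (fun _ => (1:ℂ)) (fun ν => LinearMap.trace ℂ _ (Q ν c)),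
    Finset.mul_sum]
  apply Finset.sum_congr rfl
  intro ν _
  simp only [one_smul]
  rw [yd_pieri, mul_smul_comm]

theorem Phi_swap
    (hF : ∀ μ : YoungDiagram, μ.card = n + 1 → IsYoungOrthogonalRep μ (n+1) (F μ))
    (hQ : ∀ ν : YoungDiagram, ν.card = n → IsYoungOrthogonalRep ν n (Q ν)) :
    ∑ j : Fin n, Phi F (Equiv.swap (Fin.last n) j.castSucc * permUp n c) = dD (Phi Q c) := by
  unfold Phi
  rw [Finset.sum_comm]
  have h1 : ∀ μ ∈ ydN (n+1), ∑ j : Fin n, LinearMap.trace ℂ (YoungSpace μ (n+1))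
        (F μ (Equiv.swap (Fin.last n) j.castSucc * permUp n c)) • schurPoly μ =
      (∑ ν ∈ (ydN n).filter (· ≤ μ), (fun z : ℤ => (z:ℂ)) (contSum μ - contSum ν) *
        LinearMap.trace ℂ _ (Q ν c)) • schurPoly μ := by
    intro μ hμ
    rw [mem_ydN] at hμ
    rw [← trace_down hμ (hF μ hμ) Q hQ c (fun z => (z:ℂ)), ← Finset.sum_smul]
    congr 1
    have h2 := jm_action (hF μ hμ) n (Fin.last n) (by simp)
    have h3 : ∑ i ∈ Finset.Iio (Fin.last n), F μ (Equiv.swap i (Fin.last n)) =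
        ∑ j : Fin n, F μ (Equiv.swap (Fin.last n) j.castSucc) := by
      have : Finset.Iio (Fin.last n) = Finset.univ.map Fin.castSuccEmb := by
        ext i
        simp only [Finset.mem_Iio, Finset.mem_map, Finset.mem_univ, true_and]
        constructor
        · intro h; exact ⟨⟨i, h⟩, by ext; simp⟩
        · rintro ⟨j, rfl⟩; exact Fin.castSucc_lt_last j
      rw [this, Finset.sum_map]
      apply Finset.sum_congr rfl
      intro j _
      rw [Equiv.swap_comm]; rfl
    rw [h3] at h2
    have h4 : ∑ j : Fin n, LinearMap.trace ℂ (YoungSpace μ (n+1))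
        (F μ (Equiv.swap (Fin.last n) j.castSucc * permUp n c)) =
        LinearMap.trace ℂ (YoungSpace μ (n+1)) (contOp μ (n+1) (Fin.last n) * F μ (permUp n c)) := by
      rw [← h2, Finset.sum_mul, map_sum]
      simp only [map_mul]
    rw [h4, trace_sum]
    rfl
  rw [Finset.sum_congr rfl h1, sum_swap_yd (fun z => (z:ℂ)) (fun ν => LinearMap.trace ℂ _ (Q ν c)),
    map_sum]
  apply Finset.sum_congr rfl
  intro ν _
  rw [yd_D, Derivation.map_smul]
end

theorem parts_pos' {n : ℕ} (g : Equiv.Perm (Fin n)) : ∀ r ∈ g.partition.parts, 1 ≤ r :=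
  fun _ hr => g.partition.parts_pos hr

theorem parts_sum' {n : ℕ} (g : Equiv.Perm (Fin n)) : g.partition.parts.sum = n := by
  rw [g.partition.parts_sum, Fintype.card_fin]

theorem parts_swap' {n : ℕ} (c : Equiv.Perm (Fin n)) (j : Fin n) :
    clen (permUp n c) j.castSucc ∈ c.partition.parts ∧
    (Equiv.swap (Fin.last n) j.castSucc * permUp n c).partition.parts =
      c.partition.parts.erase (clen (permUp n c) j.castSucc) + {clen (permUp n c) j.castSucc + 1} := by
  have h := parts_swap (permUp n c) (Fin.last n) j.castSucc (permUp_last c) (Fin.castSucc_lt_last j).ne'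
  rw [parts_permUp] at h
  set m := clen (permUp n c) j.castSucc
  set A := (Equiv.swap (Fin.last n) j.castSucc * permUp n c).partition.parts
  have h2 : A + {m} = c.partition.parts + {m + 1} := by
    have : {1} + (A + {m}) = {1} + (c.partition.parts + {m+1}) := by
      rw [← add_assoc, ← add_assoc, ← h]; abel
    exact add_left_cancel this
  have hm : m ∈ c.partition.parts := by
    have : m ∈ c.partition.parts + {m+1} := by rw [← h2]; simp
    rw [Multiset.mem_add, Multiset.mem_singleton] at this
    exact this.resolve_right (by omega)
  refine ⟨hm, ?_⟩
  apply add_right_cancel (b := ({m} : Multiset ℕ))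
  rw [h2]
  conv_lhs => rw [← Multiset.cons_erase hm, ← Multiset.singleton_add]
  abel

theorem sum_clen' {M : Type*} [AddCommGroup M] {n : ℕ} (c : Equiv.Perm (Fin n)) (G : ℕ → M) :
    ∑ j : Fin n, G (clen (permUp n c) j.castSucc) = (c.partition.parts.map (fun r => r • G r)).sum := by
  have h := sum_clen (permUp n c) G
  rw [Fin.sum_univ_castSucc, parts_permUp, Multiset.map_add, Multiset.sum_add, Multiset.map_singleton,
    Multiset.sum_singleton, one_smul, add_comm] at h
  have h2 : clen (permUp n c) (Fin.last n) = 1 := by rw [clen, if_pos (permUp_last c)]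
  rw [h2] at h
  exact add_left_cancel h

theorem dD_pP_parts {n : ℕ} (c : Equiv.Perm (Fin n)) :
    dD (pP c.partition.parts) =
      ∑ j : Fin n, pP (Equiv.swap (Fin.last n) j.castSucc * permUp n c).partition.parts := by
  rw [dD_pP _ (parts_pos' c), ← sum_clen' c (fun r => pP (c.partition.parts.erase r + {r+1}))]
  apply Finset.sum_congr rfl
  intro j _
  rw [(parts_swap' c j).2]

theorem exists_clen {n : ℕ} (c : Equiv.Perm (Fin n)) (m : ℕ) (hm : m ∈ c.partition.parts) :
    ∃ j : Fin n, clen (permUp n c) j.castSucc = m := by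
  by_contra hcon
  push Not at hcon
  have h := sum_clen' c (fun r => if r = m then (1:ℤ) else 0)
  rw [Finset.sum_eq_zero (fun j _ => if_neg (hcon j))] at h
  rw [← Multiset.cons_erase hm, Multiset.map_cons, Multiset.sum_cons] at h
  have h1 := parts_pos' c m hm
  have h2 : 0 ≤ (((c.partition.parts.erase m).map (fun r => r • (if r = m then (1:ℤ) else 0)))).sum := by
    apply Multiset.sum_nonneg
    intro x hx
    rw [Multiset.mem_map] at hx
    obtain ⟨r, -, rfl⟩ := hx
    positivity
  simp at h h2
  omega

theorem step {n : ℕ}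
    (ih : ∀ (F : ∀ μ : YoungDiagram, Representation ℂ (Equiv.Perm (Fin n)) (YoungSpace μ n)),
      (∀ μ : YoungDiagram, μ.card = n → IsYoungOrthogonalRep μ n (F μ)) →
      ∀ g, Phi F g = pP g.partition.parts)
    (F : ∀ μ : YoungDiagram, Representation ℂ (Equiv.Perm (Fin (n+1))) (YoungSpace μ (n+1)))
    (hF : ∀ μ : YoungDiagram, μ.card = n + 1 → IsYoungOrthogonalRep μ (n+1) (F μ)) (m : ℕ) :
    ∀ g : Equiv.Perm (Fin (n+1)), m + 1 ∈ g.partition.parts → Phi F g = pP g.partition.parts := by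
  obtain ⟨Q, hQ⟩ := exists_Q F hF
  induction m with
  | zero =>
    intro g hg
    rw [zero_add] at hg
    have hs := parts_sum' g
    rw [← Multiset.cons_erase hg, Multiset.sum_cons] at hs
    obtain ⟨c, hc⟩ := exists_perm_parts (n := n) (g.partition.parts.erase 1) (by omega)
      (fun r hr => parts_pos' g r (Multiset.mem_of_mem_erase hr))
    have hp : g.partition.parts = {1} + c.partition.parts := by
      rw [hc, Multiset.singleton_add, Multiset.cons_erase hg]
    rw [Phi_class F g (permUp n c) (by rw [parts_permUp, hp]), Phi_permUp F Q c hF hQ, ih Q hQ c, hp,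
      pP_add, pP_single]
    simp
  | succ m ihm =>
    intro g hg
    have hs := parts_sum' g
    rw [← Multiset.cons_erase hg, Multiset.sum_cons] at hs
    obtain ⟨c, hc⟩ := exists_perm_parts (n := n) (g.partition.parts.erase (m+1+1) + {m+1})
      (by rw [Multiset.sum_add, Multiset.sum_singleton]; omega)
      (fun r hr => by
        rw [Multiset.mem_add, Multiset.mem_singleton] at hr
        rcases hr with hr | hr
        · exact parts_pos' g r (Multiset.mem_of_mem_erase hr)
        · omega)
    have hmc : m + 1 ∈ c.partition.parts := by rw [hc]; simp
    have h1 := Phi_swap F Q c hF hQ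
    rw [ih Q hQ c, dD_pP_parts, ← sub_eq_zero, ← Finset.sum_sub_distrib] at h1
    have h2 : ∀ j : Fin n, Phi F (Equiv.swap (Fin.last n) j.castSucc * permUp n c) -
        pP (Equiv.swap (Fin.last n) j.castSucc * permUp n c).partition.parts =
        if clen (permUp n c) j.castSucc = m + 1 then Phi F g - pP g.partition.parts else 0 := by
      intro j
      obtain ⟨ha, hb⟩ := parts_swap' c j
      split_ifs with hj
      · have : (Equiv.swap (Fin.last n) j.castSucc * permUp n c).partition.parts = g.partition.parts := by
          rw [hb, hj, hc, add_comm _ {m+1}, Multiset.singleton_add, Multiset.erase_cons_head, add_comm,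
            Multiset.singleton_add, Multiset.cons_erase hg]
        rw [this, Phi_class F _ g this]
      · rw [sub_eq_zero]
        apply ihm
        rw [hb, Multiset.mem_add]
        left
        exact (Multiset.mem_erase_of_ne (Ne.symm hj)).2 hmc
    rw [Finset.sum_congr rfl (fun j _ => h2 j), ← Finset.sum_filter, Finset.sum_const, 
      smul_eq_zero] at h1
    rcases h1 with h1 | h1
    · obtain ⟨j, hj⟩ := exists_clen c (m+1) hmc
      rw [Finset.card_eq_zero] at h1
      have : j ∈ (Finset.univ.filter fun j : Fin n => clen (permUp n c) j.castSucc = m + 1) := by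
        simp [hj]
      rw [h1] at this
      simp at this
    · exact sub_eq_zero.1 h1

theorem base (F : ∀ μ : YoungDiagram, Representation ℂ (Equiv.Perm (Fin 0)) (YoungSpace μ 0))
    (g : Equiv.Perm (Fin 0)) : Phi F g = pP g.partition.parts := by
  have h1 : ydN 0 = {⊥} := by
    ext μ
    rw [mem_ydN, Finset.mem_singleton]
    constructor
    · intro h
      apply YoungDiagram.ext
      rw [Finset.card_eq_zero.1 h]; rfl
    · rintro rfl; rfl
  have hg : g = 1 := Subsingleton.elim _ _
  have hp : g.partition.parts = 0 := by
    rw [Multiset.eq_zero_iff_forall_notMem]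
    intro r hr
    have := parts_pos' g r hr
    have h3 := Multiset.single_le_sum (fun x _ => Nat.zero_le x) r hr
    rw [parts_sum'] at h3
    omega
  have hs : IsStandardTableau ⊥ 0 (fun i => i.elim0) := by
    refine ⟨fun i => i.elim0, ?_, fun i => i.elim0⟩
    ext x; simp
  have hc : Fintype.card {T : Fin 0 → ℕ × ℕ // IsStandardTableau ⊥ 0 T} = 1 := by
    rw [Fintype.card_eq_one_iff]
    exact ⟨⟨_, hs⟩, fun y => Subtype.ext (Subsingleton.elim _ _)⟩
  have hd : (⊥ : YoungDiagram).colLen 0 = 0 := by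
    by_contra h
    have : (0, 0) ∈ (⊥ : YoungDiagram) := YoungDiagram.mem_iff_lt_colLen.2 (Nat.pos_of_ne_zero h)
    exact YoungDiagram.notMem_bot _ this
  have hsp : schurPoly ⊥ = 1 := by
    have : IsEmpty (Fin ((⊥ : YoungDiagram).colLen 0)) := by rw [hd]; infer_instance
    unfold schurPoly
    exact Matrix.det_isEmpty
  unfold Phi
  rw [h1, Finset.sum_singleton, hg, map_one, LinearMap.trace_one, Module.finrank_fintype_fun_eq_card,
    hc, ← hg, hp, hsp]
  simp [pP]

theorem phi_eq_pP {n : ℕ} : ∀ (F : ∀ μ : YoungDiagram, Representation ℂ (Equiv.Perm (Fin n)) (YoungSpace μ n)),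
      (∀ μ : YoungDiagram, μ.card = n → IsYoungOrthogonalRep μ n (F μ)) →
      ∀ g, Phi F g = pP g.partition.parts := by
  induction n with
  | zero => intro F _ g; exact base F g
  | succ n ih =>
    intro F hF g
    have hne : g.partition.parts ≠ 0 := by
      intro h
      have := parts_sum' g
      rw [h] at this
      simp at this
    obtain ⟨r, hr⟩ := Multiset.exists_mem_of_ne_zero hne
    have := parts_pos' g r hr
    exact step ih F hF (r - 1) g (by rwa [Nat.sub_add_cancel this])

/-- **Frobenius formula.**  Let `ρ = (ρ₁, …, ρ_l)` be a partition of `n`.  Then in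
`ℂ[x₁, x₂, …]` one has `Π_{i=1}^{l} ρᵢ x_{ρᵢ} = Σ_{μ ⊢ n} χ^μ(c_ρ) S_μ`, where the
sum is over all partitions `μ` of `n`, `S_μ` is the Schur polynomial, and `χ^μ(c_ρ)` is
the value of the character of the Young orthogonal form representation `V^μ` of `Sₙ` at
any permutation `c` of cycle type `ρ` (as a multiset of cycle lengths, including fixed
points).  (The variable `xₙ` is `MvPolynomial.X (n-1)`.) -/
theorem frobenius_formula (n l : ℕ) (ρ : Fin l → ℕ)
    (hpos : ∀ i, 1 ≤ ρ i) (hsum : ∑ i, ρ i = n)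
    (F : ∀ μ : YoungDiagram, Representation ℂ (Equiv.Perm (Fin n)) (YoungSpace μ n))
    (hF : ∀ μ : YoungDiagram, μ.card = n → IsYoungOrthogonalRep μ n (F μ))
    (c : Equiv.Perm (Fin n))
    (hc : Finset.univ.val.map ρ = (Equiv.Perm.partition c).parts) :
    (∏ i : Fin l, ((ρ i : ℂ) • MvPolynomial.X (ρ i - 1) : MvPolynomial ℕ ℂ)) =
      ∑ᶠ μ : YoungDiagram, if μ.card = n then
        (LinearMap.trace ℂ (YoungSpace μ n) ((F μ) c)) • schurPoly μ
      else 0 := by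
  have h1 : (∏ i : Fin l, ((ρ i : ℂ) • MvPolynomial.X (ρ i - 1) : MvPolynomial ℕ ℂ)) =
      pP c.partition.parts := by
    have h2 : pP (Finset.univ.val.map ρ) = pP c.partition.parts := congrArg pP (by convert hc)
    rw [← h2, pP, Multiset.map_map]
    rfl
  rw [h1, ← phi_eq_pP F hF c, finsum_eq_sum_of_support_subset (s := ydN n)]
  · unfold Phi
    apply Finset.sum_congr rfl
    intro μ hμ
    rw [if_pos (mem_ydN.1 hμ)]
  · intro μ hμ
    rw [Finset.mem_coe, mem_ydN]
    by_contra h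
    exact hμ (if_neg h)
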